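/- arXiv:1912.01356 — 4 statements merged into one kernel-verified Lean document; each statement's English description precedes it below -/
import Mathlib

section
/- Let c > 0 satisfy ‖A‖ ≤ c⟨A⟩ for all A ∈ M, and fix B ∈ M. Define φ : [0,1] × M → ℝ by φ(ξ,E) = ‖E − ξB‖²/ξ for ξ > 0 and φ(0,E) = 0. Then φ is continuous on the constraint set K = {(ξ,E) ∈ [0,1] × M : ⟨E⟩ ≤ ξ}. -/
open Filter Topology

/-- The space of 3×3 real matrices, to be equipped with the Frobenius norm. -/
abbrev Mat := Matrix (Fin 3) (Fin 3) ℝ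

noncomputable instance : NormedAddCommGroup Mat := Matrix.frobeniusNormedAddCommGroup
noncomputable instance : NormedSpace ℝ Mat := Matrix.frobeniusNormedSpace

/-- Membership in `M`, the space of symmetric trace-free real 3×3 matrices. -/
def IsM (A : Mat) : Prop := A.IsSymm ∧ A.trace = 0

/-- `φ(ξ,E) = ‖E − ξB‖²/ξ` for `ξ > 0`, and `φ(0,E) = 0`. -/
noncomputable def phi (B : Mat) (p : ℝ × Mat) : ℝ :=
  if 0 < p.1 then ‖p.2 - p.1 • B‖ ^ 2 / p.1 else 0

/-- The constraint set `K = {(ξ,E) ∈ [0,1] × M : ⟨E⟩ ≤ ξ}`. -/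
def Kset (g : Mat → ℝ) : Set (ℝ × Mat) :=
  {p : ℝ × Mat | p.1 ∈ Set.Icc (0 : ℝ) 1 ∧ IsM p.2 ∧ g p.2 ≤ p.1}

/-- On the constraint set, `φ` is bounded by a multiple of `ξ`. -/
theorem phi_le_of_norm_le {B : Mat} {c : ℝ} {p : ℝ × Mat} (hp : 0 ≤ p.1)
    (h : ‖p.2‖ ≤ c * p.1) : phi B p ≤ (c + ‖B‖) ^ 2 * p.1 := by
  unfold phi
  split_ifs with h0
  · have hle : ‖p.2 - p.1 • B‖ ≤ (c + ‖B‖) * p.1 := by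
      have h1 := norm_sub_le p.2 (p.1 • B)
      rw [norm_smul, Real.norm_of_nonneg hp] at h1
      linarith
    rw [div_le_iff₀ h0]
    calc ‖p.2 - p.1 • B‖ ^ 2 ≤ ((c + ‖B‖) * p.1) ^ 2 := by gcongr
      _ = (c + ‖B‖) ^ 2 * p.1 * p.1 := by ring
  · positivity

theorem phi_nonneg (B : Mat) (p : ℝ × Mat) : 0 ≤ phi B p := by
  unfold phi
  split_ifs <;> positivity

theorem continuousAt_phi_of_pos (B : Mat) {p : ℝ × Mat} (hp : 0 < p.1) :
    ContinuousAt (phi B) p := by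
  have hcont : ContinuousAt (fun q : ℝ × Mat => ‖q.2 - q.1 • B‖ ^ 2 / q.1) p := by
    have hn : Continuous (fun A : Mat => ‖A‖) := continuous_norm
    have hd : Continuous (fun q : ℝ × Mat => q.2 - q.1 • B) := by fun_prop
    exact ((hn.comp hd).pow 2).continuousAt.div continuous_fst.continuousAt hp.ne'
  refine hcont.congr ?_
  filter_upwards [continuous_fst.continuousAt.eventually_mem (Ioi_mem_nhds hp)] with q hq
  exact (if_pos hq).symm

/-- if `‖A‖ ≤ c⟨A⟩` on `M` and `B ∈ M`, then `φ` is continuous on `K`. -/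
theorem stmt2
    (g : Mat → ℝ)
    (hgconv : ConvexOn ℝ {A : Mat | IsM A} g)
    (hghom : ∀ A : Mat, IsM A → ∀ l : ℝ, 0 ≤ l → g (l • A) = l * g A)
    (hgpos : ∀ A : Mat, IsM A → A ≠ 0 → 0 < g A)
    (c : ℝ) (hc : 0 < c)
    (hnorm : ∀ A : Mat, IsM A → ‖A‖ ≤ c * g A)
    (B : Mat) (hB : IsM B) :
    ContinuousOn (phi B) (Kset g) := by
  rintro p ⟨⟨hp0, -⟩, -, -⟩
  rcases hp0.eq_or_lt with h0 | hpos
  · have hval : phi B p = 0 := if_neg h0.not_lt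
    rw [ContinuousWithinAt, hval]
    have hlim : Tendsto (fun q : ℝ × Mat => (c + ‖B‖) ^ 2 * q.1) (𝓝[Kset g] p) (𝓝 0) := by
      have hcont : Continuous (fun q : ℝ × Mat => (c + ‖B‖) ^ 2 * q.1) := by fun_prop
      simpa [← h0] using hcont.continuousWithinAt (s := Kset g) (x := p) |>.tendsto
    refine squeeze_zero' (Eventually.of_forall (phi_nonneg B)) ?_ hlim
    filter_upwards [self_mem_nhdsWithin] with q hq
    obtain ⟨⟨hq0, -⟩, hqM, hqg⟩ := hq
    exact phi_le_of_norm_le hq0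
      ((hnorm q.2 hqM).trans (mul_le_mul_of_nonneg_left hqg hc.le))
  · exact (continuousAt_phi_of_pos B hpos).continuousWithinAt
end

section
/- Assume Δs^{AM} ≥ 0, σ^{reo} ≥ 0 and the temperature ordering M_f ≤ M_s ≤ T_0 ≤ A_s ≤ A_f. Then for every ξ ∈ (0,1], every ε^in ∈ M, and every rate pair (ξ̇, ε̇^in) ∈ ℝ × M, the dissipation function d^T(ε^in, ξ, ε̇^in, ξ̇) is nonnegative. (Nonnegativity of dissipation, required for thermodynamic consistency of the model.) -/
/-- The dissipation function `d^T` of the model: forward branch for `ξ̇ ≥ 0`,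
reverse branch for `ξ̇ < 0`. -/
noncomputable def dT (ΔsAM σreo T0 Ms Mf As Af : ℝ)
    (εin : Mat) (ξ : ℝ) (εd : Mat) (ξd : ℝ) : ℝ :=
  if 0 ≤ ξd then
    ΔsAM * (T0 - Ms + ξ * (Ms - Mf)) * |ξd| + σreo * ‖εd‖
  else
    ΔsAM * (Af - T0 + ξ * (As - Af)) * |ξd| +
      σreo * (‖(ξd / ξ) • εin‖ + ‖εd - (ξd / ξ) • εin‖)

/-- under `Δs^{AM} ≥ 0`, `σ^{reo} ≥ 0` and the temperature ordering
`M_f ≤ M_s ≤ T_0 ≤ A_s ≤ A_f`, the dissipation function is nonnegative for every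
`ξ ∈ (0,1]`, `ε^in ∈ M` and every rate pair. -/
theorem stmt10 (ΔsAM σreo T0 Ms Mf As Af : ℝ)
    (hΔs : 0 ≤ ΔsAM) (hσ : 0 ≤ σreo)
    (h1 : Mf ≤ Ms) (h2 : Ms ≤ T0) (h3 : T0 ≤ As) (h4 : As ≤ Af)
    (ξ : ℝ) (hξ : ξ ∈ Set.Ioc (0 : ℝ) 1)
    (εin : Mat) (hεin : IsM εin)
    (ξd : ℝ) (εd : Mat) (hεd : IsM εd) :
    0 ≤ dT ΔsAM σreo T0 Ms Mf As Af εin ξ εd ξd := by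
  obtain ⟨hξ0, hξ1⟩ := hξ
  unfold dT
  split_ifs
  · have hc : 0 ≤ T0 - Ms + ξ * (Ms - Mf) := by
      linarith [mul_nonneg hξ0.le (sub_nonneg.2 h1)]
    positivity
  · have hc : 0 ≤ Af - T0 + ξ * (As - Af) := by
      linarith [mul_nonneg (sub_nonneg.2 hξ1) (sub_nonneg.2 h4)]
    positivity
end

section
/- Assume Δs^{AM} ≥ 0, σ^{reo} ≥ 0 and the temperature ordering M_f ≤ M_s ≤ T_0 ≤ A_s ≤ A_f. Then for every fixed ξ ∈ (0,1] and ε^in ∈ M, the map (ξ̇, ε̇^in) ↦ d^T(ε^in, ξ, ε̇^in, ξ̇) is positively 1-homogeneous and convex on ℝ × M; in fact it equals the pointwise maximum of the two convex functions g₊(ξ̇, ε̇^in) = Δs^{AM}[T_0 − M_s + ξ(M_s − M_f)]ξ̇ + σ^{reo}‖ε̇^in‖ and g₋(ξ̇, ε̇^in) = −Δs^{AM}[A_f − T_0 + ξ(A_s − A_f)]ξ̇ − σ^{reo}(ξ̇/ξ)‖ε^in‖ + σ^{reo}‖ε̇^in − (ξ̇/ξ) ε^in‖. (Convexity of the dissipation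 in the rate variables, asserted in Remark 2 as necessary for thermodynamic consistency.) -/
/-- The convex function `g₊` (forward branch, with `|ξ̇|` replaced by `ξ̇`). -/
noncomputable def gPlus (ΔsAM σreo T0 Ms Mf : ℝ) (ξ : ℝ) (εd : Mat) (ξd : ℝ) : ℝ :=
  ΔsAM * (T0 - Ms + ξ * (Ms - Mf)) * ξd + σreo * ‖εd‖

/-- The convex function `g₋` (reverse branch, with `|ξ̇|` replaced by `−ξ̇`). -/
noncomputable def gMinus (ΔsAM σreo T0 As Af : ℝ) (εin : Mat) (ξ : ℝ) (εd : Mat) (ξd : ℝ) : ℝ :=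
  -(ΔsAM * (Af - T0 + ξ * (As - Af))) * ξd - σreo * (ξd / ξ) * ‖εin‖ +
    σreo * ‖εd - (ξd / ξ) • εin‖

section NormedSpace

variable {E : Type*} [NormedAddCommGroup E] [NormedSpace ℝ E]

/-- A linear term in the first variable plus the norm of a linear map is convex. -/
theorem convexOn_mul_fst_add_mul_norm_sub_smul (a r s : ℝ) (hs : 0 ≤ s) (e : E) :
    ConvexOn ℝ (Set.univ : Set (ℝ × E))
      (fun p => a * p.1 + s * ‖p.2 - (p.1 / r) • e‖) := by
  refine ⟨convex_univ, ?_⟩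
  rintro ⟨x, u⟩ - ⟨y, v⟩ - m n hm hn -
  have key : ‖(m • u + n • v) - ((m * x + n * y) / r) • e‖ ≤
      m * ‖u - (x / r) • e‖ + n * ‖v - (y / r) • e‖ := by
    have h : (m • u + n • v) - ((m * x + n * y) / r) • e =
        m • (u - (x / r) • e) + n • (v - (y / r) • e) := by
      module
    rw [h]
    refine (norm_add_le _ _).trans ?_
    rw [norm_smul_of_nonneg hm, norm_smul_of_nonneg hn]
  have := mul_le_mul_of_nonneg_left key hs
  simp only [Prod.smul_mk, Prod.mk_add_mk, smul_eq_mul]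
  linarith

theorem norm_sub_smul_le_add_mul_norm {r : ℝ} (hr : 0 ≤ r) (u e : E) :
    ‖u - r • e‖ ≤ ‖u‖ + r * ‖e‖ := by
  simpa [norm_smul_of_nonneg hr] using norm_sub_le u (r • e)

theorem norm_smul_of_nonpos {r : ℝ} (hr : r ≤ 0) (e : E) : ‖r • e‖ = -r * ‖e‖ := by
  rw [norm_smul, Real.norm_of_nonpos hr]

theorem norm_le_norm_sub_smul_sub_mul_norm {r : ℝ} (hr : r ≤ 0) (u e : E) :
    ‖u‖ ≤ ‖u - r • e‖ - r * ‖e‖ := by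
  have h := norm_add_le (u - r • e) (r • e)
  rw [sub_add_cancel, norm_smul_of_nonpos hr] at h
  linarith

end NormedSpace

theorem convexOn_gPlus (ΔsAM σreo T0 Ms Mf ξ : ℝ) (hσ : 0 ≤ σreo) :
    ConvexOn ℝ (Set.univ : Set (ℝ × Mat)) (fun p => gPlus ΔsAM σreo T0 Ms Mf ξ p.2 p.1) := by
  have h := convexOn_mul_fst_add_mul_norm_sub_smul
    (ΔsAM * (T0 - Ms + ξ * (Ms - Mf))) 1 σreo hσ (0 : Mat)
  simp only [smul_zero, sub_zero] at h
  exact h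

theorem convexOn_gMinus (ΔsAM σreo T0 As Af ξ : ℝ) (εin : Mat) (hσ : 0 ≤ σreo) :
    ConvexOn ℝ (Set.univ : Set (ℝ × Mat))
      (fun p => gMinus ΔsAM σreo T0 As Af εin ξ p.2 p.1) := by
  have h := convexOn_mul_fst_add_mul_norm_sub_smul
    (-(ΔsAM * (Af - T0 + ξ * (As - Af))) - σreo / ξ * ‖εin‖) ξ σreo hσ εin
  convert h using 2 with p
  unfold gMinus
  ring

theorem dT_eq_max (ΔsAM σreo T0 Ms Mf As Af : ℝ) (hΔs : 0 ≤ ΔsAM) (hσ : 0 ≤ σreo)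
    (h1 : Mf ≤ Ms) (h2 : Ms ≤ T0) (h3 : T0 ≤ As) (h4 : As ≤ Af)
    (ξ : ℝ) (hξ : ξ ∈ Set.Ioc (0 : ℝ) 1) (εin : Mat) (ξd : ℝ) (εd : Mat) :
    dT ΔsAM σreo T0 Ms Mf As Af εin ξ εd ξd =
      max (gPlus ΔsAM σreo T0 Ms Mf ξ εd ξd)
        (gMinus ΔsAM σreo T0 As Af εin ξ εd ξd) := by
  obtain ⟨hξ0, hξ1⟩ := hξ
  have ha : 0 ≤ ΔsAM * (T0 - Ms + ξ * (Ms - Mf)) :=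
    mul_nonneg hΔs (add_nonneg (by linarith) (mul_nonneg hξ0.le (by linarith)))
  have hb : 0 ≤ ΔsAM * (Af - T0 + ξ * (As - Af)) := mul_nonneg hΔs (by nlinarith)
  unfold dT gPlus gMinus
  split_ifs with h
  · have hr : 0 ≤ ξd / ξ := div_nonneg h hξ0.le
    rw [abs_of_nonneg h, max_eq_left]
    have := mul_le_mul_of_nonneg_left (norm_sub_smul_le_add_mul_norm hr εd εin) hσ
    have := mul_nonneg ha h
    have := mul_nonneg hb h
    linarith
  · have h' : ξd ≤ 0 := (not_le.mp h).le
    have hr : ξd / ξ ≤ 0 := div_nonpos_of_nonpos_of_nonneg h' hξ0.le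
    rw [abs_of_nonpos h', max_eq_right]
    · rw [norm_smul_of_nonpos hr]
      ring
    · have := mul_le_mul_of_nonneg_left (norm_le_norm_sub_smul_sub_mul_norm hr εd εin) hσ
      have := mul_nonpos_of_nonneg_of_nonpos ha h'
      have := mul_nonpos_of_nonneg_of_nonpos hb h'
      linarith

theorem gPlus_smul (ΔsAM σreo T0 Ms Mf ξ : ℝ) {l : ℝ} (hl : 0 ≤ l) (ξd : ℝ) (εd : Mat) :
    gPlus ΔsAM σreo T0 Ms Mf ξ (l • εd) (l * ξd) =
      l * gPlus ΔsAM σreo T0 Ms Mf ξ εd ξd := by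
  have h : ‖l • εd‖ = l * ‖εd‖ := norm_smul_of_nonneg hl εd
  unfold gPlus
  rw [h]
  ring

theorem gMinus_smul (ΔsAM σreo T0 As Af ξ : ℝ) (εin : Mat) {l : ℝ} (hl : 0 ≤ l)
    (ξd : ℝ) (εd : Mat) :
    gMinus ΔsAM σreo T0 As Af εin ξ (l • εd) (l * ξd) =
      l * gMinus ΔsAM σreo T0 As Af εin ξ εd ξd := by
  have h : ‖l • εd - (l * ξd / ξ) • εin‖ = l * ‖εd - (ξd / ξ) • εin‖ := by
    rw [mul_div_assoc, mul_smul, ← smul_sub]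
    exact norm_smul_of_nonneg hl _
  unfold gMinus
  rw [h]
  ring

/-- for fixed `ξ ∈ (0,1]` and `ε^in ∈ M`, the dissipation is positively
1-homogeneous and convex in the rates `(ξ̇, ε̇^in)`; in fact it equals the pointwise
maximum of the two convex functions `g₊` and `g₋`. -/
theorem stmt11 (ΔsAM σreo T0 Ms Mf As Af : ℝ)
    (hΔs : 0 ≤ ΔsAM) (hσ : 0 ≤ σreo)
    (h1 : Mf ≤ Ms) (h2 : Ms ≤ T0) (h3 : T0 ≤ As) (h4 : As ≤ Af)
    (ξ : ℝ) (hξ : ξ ∈ Set.Ioc (0 : ℝ) 1)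
    (εin : Mat) (hεin : IsM εin) :
    (∀ (l : ℝ), 0 ≤ l → ∀ (ξd : ℝ) (εd : Mat),
      dT ΔsAM σreo T0 Ms Mf As Af εin ξ (l • εd) (l * ξd) =
        l * dT ΔsAM σreo T0 Ms Mf As Af εin ξ εd ξd) ∧
    ConvexOn ℝ (Set.univ : Set (ℝ × Mat))
      (fun p => dT ΔsAM σreo T0 Ms Mf As Af εin ξ p.2 p.1) ∧
    ConvexOn ℝ (Set.univ : Set (ℝ × Mat))
      (fun p => gPlus ΔsAM σreo T0 Ms Mf ξ p.2 p.1) ∧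
    ConvexOn ℝ (Set.univ : Set (ℝ × Mat))
      (fun p => gMinus ΔsAM σreo T0 As Af εin ξ p.2 p.1) ∧
    (∀ (ξd : ℝ) (εd : Mat),
      dT ΔsAM σreo T0 Ms Mf As Af εin ξ εd ξd =
        max (gPlus ΔsAM σreo T0 Ms Mf ξ εd ξd)
            (gMinus ΔsAM σreo T0 As Af εin ξ εd ξd)) := by
  have hmax := dT_eq_max ΔsAM σreo T0 Ms Mf As Af hΔs hσ h1 h2 h3 h4 ξ hξ εin
  have hplus := convexOn_gPlus ΔsAM σreo T0 Ms Mf ξ hσ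
  have hminus := convexOn_gMinus ΔsAM σreo T0 As Af ξ εin hσ
  refine ⟨fun l hl ξd εd => ?_, ?_, hplus, hminus, hmax⟩
  · rw [hmax, hmax, gPlus_smul _ _ _ _ _ _ hl, gMinus_smul _ _ _ _ _ _ _ hl,
      mul_max_of_nonneg _ _ hl]
  · simp only [hmax]
    exact hplus.sup hminus
end

section
/- Let Ω ⊂ ℝ³ be a bounded measurable set of positive Lebesgue measure, ω > 0, and ⟨·⟩ : M → ℝ a convex, positively 1-homogeneous, continuous function positive on nonzero matrices. Let e ∈ L^∞(Ω; Sym) be a given total-strain field, λ ∈ ℝ a chemical-energy coefficient, C_MA, C_AM ≥ 0 interaction constants, and 𝕊_A, 𝕊_M symmetric positive-definite linear operators on Sym (compliances of austenite and martensite), with elastic energy density w(ξ, E) = (1/2)(e − E) : (ξ𝕊_M + (1−ξ)𝕊_A)^{−1} : (e − E). Let (ξ₀, E₀) belong to the admissible set 𝒱 = {(ξ, E) ∈ L^∞(Ω) × L^∞(Ω; M) : 0 ≤ ξ(x) ≤ 1 and ⟨E(x)⟩ ≤ ξ(x) a.e.}, and let the dissipation increment D(ξ, E) = ∫_Ω d^T(E₀(x),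 ξ₀(x), E(x) − E₀(x), ξ(x) − ξ₀(x)) dx use the rate-independent dissipation function d^T with nonnegative parameters Δs^{AM}, σ^{reo} ≥ 0 and M_f ≤ M_s ≤ T_0 ≤ A_s ≤ A_f (with the forward branch used wherever ξ₀(x) = 0). Then the functional 𝔈(ξ, E) = ∫_Ω [ w(ξ(x), E(x)) + λ ξ(x) + C_MA r₁(ξ(x), E(x), (E)_ω(x)) + C_AM (1 − ξ(x)) ‖(E)_ω(x)‖² ] dx + D(ξ, E), where r₁(ξ, E, b) = ‖E − ξ b‖²/ξ for ξ > 0 and r₁(0, E, b) = 0, attains its minimum on 𝒱. (This is the internal-variable reduction of Proposition 1 — existence of a solution of the time-incremental problem (TIP) at given strain — proved by weak-* compactness, weak-* closedness of 𝒱, convexity of the local terms, and strong L^p convergence of the nonlocal averages.) -/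
open MeasureTheory Filter Topology

instance : CompleteSpace Mat := FiniteDimensional.complete ℝ Mat

/-- The Frobenius inner product `A : B = tr(Aᵀ B)`. -/
noncomputable def finner (A B : Mat) : ℝ := (A.transpose * B).trace

/-- Physical space `ℝ³`. -/
abbrev E3 := EuclideanSpace ℝ (Fin 3)

/-- The three-dimensional Gaussian kernel `𝒢_ω(z) = (2π)^{−3/2} ω^{−3} exp(−‖z‖²/(2ω²))`. -/
noncomputable def gaussK (ω : ℝ) (z : E3) : ℝ :=
  (2 * Real.pi) ^ (-(3 : ℝ) / 2) * ω ^ (-(3 : ℝ)) * Real.exp (-‖z‖ ^ 2 / (2 * ω ^ 2))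

/-- Nonlocal average of a matrix field. -/
noncomputable def nlAvgM (Ω : Set E3) (ω : ℝ) (f : E3 → Mat) (x : E3) : Mat :=
  (∫ y in Ω, gaussK ω (x - y))⁻¹ • ∫ y in Ω, gaussK ω (x - y) • f y

/-- First (perspective-type) interaction term: `r₁(ξ,E,b) = ‖E − ξ b‖²/ξ` for `ξ > 0`,
and `r₁(0,E,b) = 0`. -/
noncomputable def r1 (ξ : ℝ) (A b : Mat) : ℝ :=
  if 0 < ξ then ‖A - ξ • b‖ ^ 2 / ξ else 0

/-- The admissible set `𝒱` of internal variables: measurable fields with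
`0 ≤ ξ(x) ≤ 1`, `E(x) ∈ M` and `⟨E(x)⟩ ≤ ξ(x)` a.e. on `Ω`. -/
def Adm (Ω : Set E3) (g : Mat → ℝ) (ξ : E3 → ℝ) (E : E3 → Mat) : Prop :=
  AEStronglyMeasurable ξ (volume.restrict Ω) ∧
  AEStronglyMeasurable E (volume.restrict Ω) ∧
  ∀ᵐ x ∂volume.restrict Ω, 0 ≤ ξ x ∧ ξ x ≤ 1 ∧ IsM (E x) ∧ g (E x) ≤ ξ x

/-- The reduced total functional `𝔈(ξ,E)`: elastic energy (with compliance inverse `Cst`),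
chemical energy, the two nonlocal interaction terms, and the dissipation increment from
`(ξ₀, E₀)`. -/
noncomputable def ETot (Ω : Set E3) (ω : ℝ) (e : E3 → Mat) (lam CMA CAM : ℝ)
    (Cst : ℝ → Mat →ₗ[ℝ] Mat) (ΔsAM σreo T0 Ms Mf As Af : ℝ)
    (ξ0 : E3 → ℝ) (E0 : E3 → Mat) (ξ : E3 → ℝ) (E : E3 → Mat) : ℝ :=
  ∫ x in Ω,
    ((1 / 2) * finner (Cst (ξ x) (e x - E x)) (e x - E x) + lam * ξ x
      + CMA * r1 (ξ x) (E x) (nlAvgM Ω ω E x)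
      + CAM * (1 - ξ x) * ‖nlAvgM Ω ω E x‖ ^ 2
      + dT ΔsAM σreo T0 Ms Mf As Af (E0 x) (ξ0 x) (E x - E0 x) (ξ x - ξ0 x))

theorem exists_subseq_weak_tendsto_of_hilbert {H : Type*} [NormedAddCommGroup H]
    [InnerProductSpace ℝ H] [CompleteSpace H] [TopologicalSpace.SeparableSpace H]
    (f : ℕ → H) (R : ℝ) (hf : ∀ n, ‖f n‖ ≤ R) :
    ∃ (l : H) (ns : ℕ → ℕ), StrictMono ns ∧
      ∀ φ : StrongDual ℝ H, Tendsto (fun n => φ (f (ns n))) atTop (𝓝 (φ l)) := by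
  have hc := WeakDual.isSeqCompact_closedBall ℝ H (0 : StrongDual ℝ H) R
  obtain ⟨a, -, ns, hns, hlim⟩ := hc
    (x := fun n => StrongDual.toWeakDual (InnerProductSpace.toDual ℝ H (f n)))
    (fun n => by simpa using hf n)
  refine ⟨(InnerProductSpace.toDual ℝ H).symm (WeakDual.toStrongDual a), ns, hns, fun φ => ?_⟩
  have h := tendsto_iff_forall_eval_tendsto_topDualPairing.1 hlim
    ((InnerProductSpace.toDual ℝ H).symm φ)
  have e1 : ∀ v : H, φ v = inner ℝ v ((InnerProductSpace.toDual ℝ H).symm φ) := fun v => by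
    rw [real_inner_comm, InnerProductSpace.toDual_symm_apply]
  simp only [e1, InnerProductSpace.toDual_symm_apply]
  exact h

theorem tendsto_sub_of_continuousOn_compact_prod {V W : Type*} [PseudoMetricSpace V]
    [NormedAddCommGroup W] [NormedSpace ℝ W] [FiniteDimensional ℝ W]
    {K : Set V} (hK : IsCompact K) {G : V → W → ℝ}
    (hG : ContinuousOn (fun p : V × W => G p.1 p.2) (K ×ˢ Set.univ)) {v : ℕ → V} {b : ℕ → W}
    {b' : W} (hv : ∀ n, v n ∈ K) (hb : Tendsto b atTop (𝓝 b')) :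
    Tendsto (fun n => G (v n) b' - G (v n) (b n)) atTop (𝓝 0) := by
  obtain ⟨r, hr⟩ := (Metric.isBounded_range_of_tendsto b hb).exists_norm_le
  have hbr : ∀ n, b n ∈ Metric.closedBall (0 : W) r := fun n => by
    simpa using hr _ ⟨n, rfl⟩
  have hbr' : b' ∈ Metric.closedBall (0 : W) r :=
    Metric.isClosed_closedBall.mem_of_tendsto hb (Eventually.of_forall hbr)
  have : ProperSpace W := FiniteDimensional.proper ℝ W
  have huc := (hK.prod (isCompact_closedBall (0 : W) r)).uniformContinuousOn_of_continuous
    (hG.mono (Set.prod_mono_right (Set.subset_univ _)))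
  rw [Metric.uniformContinuousOn_iff] at huc
  rw [Metric.tendsto_atTop]
  intro ε hε
  obtain ⟨δ, hδ, h⟩ := huc ε hε
  obtain ⟨N, hN⟩ := Metric.tendsto_atTop.1 hb δ hδ
  refine ⟨N, fun n hn => ?_⟩
  have := h (v n, b') ⟨hv n, hbr'⟩ (v n, b n) ⟨hv n, hbr n⟩ (by
    rw [Prod.dist_eq, dist_self, dist_comm]
    exact max_lt hδ (hN n hn))
  simpa [Real.dist_eq] using this

section DirectMethod

variable {X : Type*} [MeasurableSpace X] {μ : Measure X}
  {V W : Type*} [NormedAddCommGroup V] [NormedSpace ℝ V]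
  [NormedAddCommGroup W] [NormedSpace ℝ W]

theorem exists_subseq_weak_tendsto_Lp [FiniteDimensional ℝ V]
    [MeasurableSpace.CountablyGenerated X] [IsFiniteMeasure μ]
    (f : ℕ → Lp V 2 μ) (R : ℝ) (hf : ∀ n, ‖f n‖ ≤ R) :
    ∃ (l : Lp V 2 μ) (ns : ℕ → ℕ), StrictMono ns ∧
      ∀ φ : StrongDual ℝ (Lp V 2 μ), Tendsto (fun n => φ (f (ns n))) atTop (𝓝 (φ l)) := by
  let T : V ≃L[ℝ] EuclideanSpace ℝ (Fin (Module.finrank ℝ V)) := toEuclidean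
  let A := (T : V →L[ℝ] EuclideanSpace ℝ (Fin (Module.finrank ℝ V))).compLpL 2 μ
  let B := (T.symm : EuclideanSpace ℝ (Fin (Module.finrank ℝ V)) →L[ℝ] V).compLpL 2 μ
  have hBA : ∀ v, B (A v) = v := fun v => by
    apply Lp.ext
    filter_upwards
      [(T.symm : EuclideanSpace ℝ (Fin (Module.finrank ℝ V)) →L[ℝ] V).coeFn_compLpL (A v),
        (T : V →L[ℝ] EuclideanSpace ℝ (Fin (Module.finrank ℝ V))).coeFn_compLpL v]
      with x h1 h2
    rw [h1, h2]
    simp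
  have : Fact ((2 : ENNReal) ≠ ⊤) := ⟨ENNReal.ofNat_ne_top⟩
  obtain ⟨l, ns, hns, h⟩ := exists_subseq_weak_tendsto_of_hilbert (fun n => A (f n)) (‖A‖ * R)
    (fun n => (A.le_opNorm _).trans (by gcongr; exact hf n))
  refine ⟨B l, ns, hns, fun φ => ?_⟩
  have := h (φ.comp B)
  simpa [hBA] using this

theorem tendsto_of_weak_tendsto [FiniteDimensional ℝ W] {H : Type*} [NormedAddCommGroup H]
    [NormedSpace ℝ H] {f : ℕ → H} {l : H}
    (h : ∀ φ : StrongDual ℝ H, Tendsto (fun n => φ (f n)) atTop (𝓝 (φ l)))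
    (Φ : H →L[ℝ] W) : Tendsto (fun n => Φ (f n)) atTop (𝓝 (Φ l)) := by
  let b := Module.finBasis ℝ W
  have h1 : Tendsto (fun n => b.equivFunL (Φ (f n))) atTop (𝓝 (b.equivFunL (Φ l))) := by
    rw [tendsto_pi_nhds]
    intro i
    exact h (((ContinuousLinearMap.proj (R := ℝ) (φ := fun _ => ℝ) i).comp
      (b.equivFunL : W →L[ℝ] Fin (Module.finrank ℝ W) → ℝ)).comp Φ)
  have h2 := (b.equivFunL.symm.continuous.tendsto _).comp h1
  simpa [Function.comp_def] using h2

theorem mem_of_weak_tendsto {H : Type*} [NormedAddCommGroup H] [NormedSpace ℝ H]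
    {f : ℕ → H} {l : H} (h : ∀ φ : StrongDual ℝ H, Tendsto (fun n => φ (f n)) atTop (𝓝 (φ l)))
    {S : Set H} (hS : Convex ℝ S) (hSc : IsClosed S) (hf : ∀ᶠ n in atTop, f n ∈ S) : l ∈ S := by
  by_contra hl
  obtain ⟨φ, u, h1, h2⟩ := geometric_hahn_banach_point_closed hS hSc hl
  have : u ≤ φ l := ge_of_tendsto (h φ) (hf.mono fun n hn => (h2 _ hn).le)
  linarith

/-- Integration against a square-integrable scalar weight, as a continuous linear map on `L²`. -/
theorem exists_clm_integral_smul [FiniteDimensional ℝ V] [CompleteSpace W] (k : X → ℝ)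
    (hk : MemLp k 2 μ) (L : V →L[ℝ] W) :
    ∃ Φ : Lp V 2 μ →L[ℝ] W, ∀ f : Lp V 2 μ, Φ f = ∫ y, k y • L (f y) ∂μ := by
  have hInt : ∀ f : Lp V 2 μ, Integrable (fun y => k y • f y) μ := fun f =>
    memLp_one_iff_integrable.1 ((Lp.memLp f).smul hk)
  have hV : CompleteSpace V := FiniteDimensional.complete ℝ V
  let Ψ : Lp V 2 μ →ₗ[ℝ] V :=
    { toFun := fun f => ∫ y, k y • f y ∂μ
      map_add' := fun f g => by
        rw [← integral_add (hInt f) (hInt g)]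
        apply integral_congr_ae
        filter_upwards [Lp.coeFn_add f g] with y hy
        rw [hy, Pi.add_apply, smul_add]
      map_smul' := fun c f => by
        rw [RingHom.id_apply, ← integral_smul]
        apply integral_congr_ae
        filter_upwards [Lp.coeFn_smul c f] with y hy
        rw [hy, Pi.smul_apply, smul_comm] }
  have hΨ : ∀ f, ‖Ψ f‖ ≤ (eLpNorm k 2 μ).toReal * ‖f‖ := fun f => by
    have h1 : ‖Ψ f‖ ≤ (eLpNorm (fun y => k y • f y) 1 μ).toReal := by
      have := norm_integral_le_lintegral_norm (μ := μ) (fun y => k y • f y)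
      rw [eLpNorm_one_eq_lintegral_enorm]
      simp only [ofReal_norm] at this
      exact this
    refine h1.trans ?_
    rw [Lp.norm_def, ← ENNReal.toReal_mul]
    refine ENNReal.toReal_mono (ENNReal.mul_ne_top hk.2.ne (Lp.eLpNorm_ne_top f)) ?_
    exact eLpNorm_smul_le_mul_eLpNorm (Lp.aestronglyMeasurable f) hk.1
  refine ⟨L.comp (Ψ.mkContinuous _ hΨ), fun f => ?_⟩
  change L (∫ y, k y • f y ∂μ) = _
  rw [← L.integral_comp_comm (hInt f)]
  simp

/-- Fields that take values in `K` almost everywhere. -/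
def IsFieldIn (μ : Measure X) (K : Set V) (u : X → V) : Prop :=
  AEStronglyMeasurable u μ ∧ ∀ᵐ x ∂μ, u x ∈ K

theorem tendsto_integral_of_bounded [IsFiniteMeasure μ] {F : ℕ → X → ℝ} {f : X → ℝ} (C : ℝ)
    (hm : ∀ n, AEStronglyMeasurable (F n) μ) (hb : ∀ n, ∀ᵐ x ∂μ, |F n x| ≤ C)
    (hl : ∀ᵐ x ∂μ, Tendsto (fun n => F n x) atTop (𝓝 (f x))) :
    Tendsto (fun n => ∫ x, F n x ∂μ) atTop (𝓝 (∫ x, f x ∂μ)) :=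
  tendsto_integral_of_dominated_convergence (fun _ => C) hm (integrable_const C) hb hl

theorem convex_isClosed_sublevel [IsFiniteMeasure μ] {K : Set V}
    (hKc : IsCompact K) (hKconv : Convex ℝ K) (G : X → V → ℝ)
    (hGm : ∀ u, IsFieldIn μ K u → AEStronglyMeasurable (fun x => G x (u x)) μ)
    (hGconv : ∀ᵐ x ∂μ, ConvexOn ℝ K (G x)) (hGcont : ∀ᵐ x ∂μ, ContinuousOn (G x) K)
    (C : ℝ) (hGb : ∀ᵐ x ∂μ, ∀ v ∈ K, |G x v| ≤ C) (c : ℝ) :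
    Convex ℝ {f : Lp V 2 μ | (∀ᵐ x ∂μ, f x ∈ K) ∧ ∫ x, G x (f x) ∂μ ≤ c} ∧
      IsClosed {f : Lp V 2 μ | (∀ᵐ x ∂μ, f x ∈ K) ∧ ∫ x, G x (f x) ∂μ ≤ c} := by
  have hInt : ∀ f : Lp V 2 μ, (∀ᵐ x ∂μ, f x ∈ K) → Integrable (fun x => G x (f x)) μ :=
    fun f hf => Integrable.of_bound (hGm f ⟨Lp.aestronglyMeasurable f, hf⟩) C (by
      filter_upwards [hf, hGb] with x h1 h2 using h2 _ h1)
  constructor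
  · rintro f ⟨hf, hfc⟩ g ⟨hg, hgc⟩ a b ha hb hab
    have heq : ∀ᵐ x ∂μ, (a • f + b • g : Lp V 2 μ) x = a • f x + b • g x := by
      filter_upwards [Lp.coeFn_add (a • f) (b • g), Lp.coeFn_smul a f, Lp.coeFn_smul b g]
        with x h1 h2 h3
      rw [h1, Pi.add_apply, h2, h3]
      rfl
    have hK : ∀ᵐ x ∂μ, (a • f + b • g : Lp V 2 μ) x ∈ K := by
      filter_upwards [heq, hf, hg] with x h1 h2 h3
      rw [h1]
      exact hKconv h2 h3 ha hb hab
    refine ⟨hK, ?_⟩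
    calc ∫ x, G x ((a • f + b • g : Lp V 2 μ) x) ∂μ
        ≤ ∫ x, (a * G x (f x) + b * G x (g x)) ∂μ := by
          apply integral_mono_ae (hInt _ hK)
            (((hInt f hf).const_mul a).add ((hInt g hg).const_mul b))
          filter_upwards [heq, hf, hg, hGconv] with x h1 h2 h3 h4
          simp only [h1]
          exact h4.2 h2 h3 ha hb hab
      _ = a * ∫ x, G x (f x) ∂μ + b * ∫ x, G x (g x) ∂μ := by
          rw [integral_add ((hInt f hf).const_mul a) ((hInt g hg).const_mul b),
            integral_const_mul, integral_const_mul]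
      _ ≤ a * c + b * c := by gcongr
      _ = c := by rw [← add_mul, hab, one_mul]
  · apply IsSeqClosed.isClosed
    intro f l hf hl
    obtain ⟨ns, -, hns⟩ := (tendstoInMeasure_of_tendsto_Lp hl).exists_seq_tendsto_ae
    have hfK : ∀ᵐ x ∂μ, ∀ n, f n x ∈ K := ae_all_iff.2 fun n => (hf n).1
    have hlK : ∀ᵐ x ∂μ, l x ∈ K := by
      filter_upwards [hns, hfK] with x h1 h2
      exact hKc.isClosed.mem_of_tendsto h1 (Eventually.of_forall fun n => h2 _)
    refine ⟨hlK, ?_⟩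
    refine le_of_tendsto (tendsto_integral_of_bounded (F := fun n x => G x (f (ns n) x)) C
      (fun n => hGm _ ⟨Lp.aestronglyMeasurable _, (hf _).1⟩)
      (fun n => by filter_upwards [(hf (ns n)).1, hGb] with x h1 h2 using h2 _ h1) ?_)
      (Eventually.of_forall fun n => (hf (ns n)).2)
    filter_upwards [hns, hfK, hlK, hGcont] with x h1 h2 h3 h4
    exact (h4 _ h3).tendsto.comp
      (tendsto_nhdsWithin_iff.2 ⟨h1, Eventually.of_forall fun n => h2 _⟩)

/-- Direct method for functionals with a convex local part and a nonlocal argument given by an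
integral operator. -/
theorem exists_minimizer_nonlocal [FiniteDimensional ℝ V] [FiniteDimensional ℝ W]
    [MeasurableSpace.CountablyGenerated X] [IsFiniteMeasure μ]
    {K : Set V} (hKc : IsCompact K) (hKconv : Convex ℝ K)
    (k : X → X → ℝ) (hk : ∀ x, MemLp (k x) 2 μ) (L : V →L[ℝ] W) (R : ℝ)
    (hBm : ∀ u, IsFieldIn μ K u → AEStronglyMeasurable (fun x => ∫ y, k x y • L (u y) ∂μ) μ)
    (hBb : ∀ u, IsFieldIn μ K u → ∀ x, ‖∫ y, k x y • L (u y) ∂μ‖ ≤ R)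
    (G : X → V → W → ℝ)
    (hGm : ∀ u b, IsFieldIn μ K u → AEStronglyMeasurable b μ →
      AEStronglyMeasurable (fun x => G x (u x) (b x)) μ)
    (hGconv : ∀ᵐ x ∂μ, ∀ w, ConvexOn ℝ K (fun v => G x v w))
    (hGcont : ∀ᵐ x ∂μ, ContinuousOn (fun p : V × W => G x p.1 p.2) (K ×ˢ Set.univ))
    (C : ℝ) (hGb : ∀ᵐ x ∂μ, ∀ v ∈ K, ∀ w, ‖w‖ ≤ R → |G x v w| ≤ C)
    (hne : ∃ u, IsFieldIn μ K u) :
    ∃ u, IsFieldIn μ K u ∧ ∀ u', IsFieldIn μ K u' →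
      ∫ x, G x (u x) (∫ y, k x y • L (u y) ∂μ) ∂μ ≤
        ∫ x, G x (u' x) (∫ y, k x y • L (u' y) ∂μ) ∂μ := by
  have hW : CompleteSpace W := FiniteDimensional.complete ℝ W
  set B : (X → V) → X → W := fun u x => ∫ y, k x y • L (u y) ∂μ with hB
  set J : (X → V) → ℝ := fun u => ∫ x, G x (u x) (B u x) ∂μ with hJ
  have hGbB : ∀ u u', IsFieldIn μ K u → IsFieldIn μ K u' → ∀ᵐ x ∂μ, |G x (u x) (B u' x)| ≤ C := by
    intro u u' hu hu'
    filter_upwards [hGb, hu.2] with x h1 h2 using h1 _ h2 _ (hBb u' hu' x)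
  have hInt : ∀ u u', IsFieldIn μ K u → IsFieldIn μ K u' →
      Integrable (fun x => G x (u x) (B u' x)) μ := fun u u' hu hu' =>
    Integrable.of_bound (hGm u _ hu (hBm u' hu')) C (hGbB u u' hu hu')
  let vals : Set ℝ := J '' {u | IsFieldIn μ K u}
  have hvne : vals.Nonempty := hne.imp' J fun u hu => ⟨u, hu, rfl⟩
  have hvb : BddBelow vals := by
    refine ⟨-(C * μ.real Set.univ), ?_⟩
    rintro _ ⟨u, hu, rfl⟩
    have := norm_integral_le_of_norm_le_const (f := fun x => G x (u x) (B u x)) (hGbB u u hu hu)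
    exact (abs_le.1 this).1
  obtain ⟨s, -, hs, hsm⟩ := exists_seq_tendsto_sInf hvne hvb
  choose u hu hus using hsm
  obtain ⟨D, hD⟩ := hKc.isBounded.exists_norm_le
  have hmem : ∀ n, MemLp (u n) 2 μ := fun n =>
    MemLp.of_bound (hu n).1 D ((hu n).2.mono fun x hx => hD _ hx)
  let f : ℕ → Lp V 2 μ := fun n => (hmem n).toLp
  have hfu : ∀ n, f n =ᵐ[μ] u n := fun n => (hmem n).coeFn_toLp
  have hfF : ∀ n, ∀ᵐ x ∂μ, f n x ∈ K := fun n => by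
    filter_upwards [hfu n, (hu n).2] with x h1 h2
    rwa [h1]
  have hfb : ∀ n, ‖f n‖ ≤ (μ.real Set.univ) ^ ((2 : ENNReal).toReal)⁻¹ * |D| := fun n => by
    refine Lp.norm_le_of_ae_bound (abs_nonneg D) ?_
    filter_upwards [hfF n] with x hx using (hD _ hx).trans (le_abs_self D)
  obtain ⟨l, ns, hns, hw⟩ := exists_subseq_weak_tendsto_Lp f _ hfb
  have hlim : Tendsto (fun n => J (u (ns n))) atTop (𝓝 (sInf vals)) := by
    have := hs.comp hns.tendsto_atTop
    refine this.congr fun n => (hus (ns n)).symm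
  have hBf : ∀ n x, B (f n) x = B (u n) x := fun n x => by
    apply integral_congr_ae
    filter_upwards [hfu n] with y hy
    rw [hy]
  have hblim : ∀ x, Tendsto (fun n => B (u (ns n)) x) atTop (𝓝 (B l x)) := fun x => by
    obtain ⟨Φ, hΦ⟩ := exists_clm_integral_smul (k x) (hk x) L
    have := tendsto_of_weak_tendsto hw Φ
    simp only [hΦ] at this
    refine this.congr fun n => hBf _ x
  have hlK : IsFieldIn μ K l := by
    refine ⟨Lp.aestronglyMeasurable l, ?_⟩
    obtain ⟨h1, h2⟩ := convex_isClosed_sublevel (μ := μ) hKc hKconv (fun _ _ => 0)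
      (fun _ _ => aestronglyMeasurable_const) (ae_of_all _ fun _ => convexOn_const 0 hKconv)
      (ae_of_all _ fun _ => continuousOn_const) 0 (by simp) 0
    exact (mem_of_weak_tendsto hw h1 h2
      (Eventually.of_forall fun n => ⟨hfF _, by simp⟩)).1
  have hdiff : Tendsto (fun n => ∫ x, (G x (u (ns n) x) (B l x) -
      G x (u (ns n) x) (B (u (ns n)) x)) ∂μ) atTop (𝓝 0) := by
    rw [← integral_zero X ℝ (μ := μ)]
    apply tendsto_integral_of_bounded (C + C)
    · exact fun n => ((hInt _ _ (hu _) hlK).sub (hInt _ _ (hu _) (hu _))).1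
    · intro n
      filter_upwards [hGbB _ _ (hu (ns n)) hlK, hGbB _ _ (hu (ns n)) (hu (ns n))] with x h1 h2
      exact (abs_sub _ _).trans (add_le_add h1 h2)
    · filter_upwards [hGcont, ae_all_iff.2 fun n => (hu n).2] with x h1 h2
      exact tendsto_sub_of_continuousOn_compact_prod hKc h1 (fun n => h2 _) (hblim x)
  have hlim' : Tendsto (fun n => ∫ x, G x (u (ns n) x) (B l x) ∂μ) atTop (𝓝 (sInf vals)) := by
    have := hdiff.add hlim
    rw [zero_add] at this
    refine this.congr fun n => ?_
    rw [integral_sub (hInt _ _ (hu _) hlK) (hInt _ _ (hu _) (hu _)), hJ]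
    simp
  have hJl : J l ≤ sInf vals := by
    apply le_of_forall_gt_imp_ge_of_dense
    intro c hc
    obtain ⟨h1, h2⟩ := convex_isClosed_sublevel (μ := μ) hKc hKconv (fun x v => G x v (B l x))
      (fun v hv => hGm v _ hv (hBm l hlK)) (hGconv.mono fun x hx => hx _)
      (hGcont.mono fun x hx => hx.comp (continuousOn_id.prodMk continuousOn_const)
        fun v hv => ⟨hv, trivial⟩)
      C (hGb.mono fun x hx v hv => hx v hv _ (hBb l hlK x)) c
    refine (mem_of_weak_tendsto hw h1 h2 ?_).2
    filter_upwards [hlim'.eventually (gt_mem_nhds hc)] with n hn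
    refine ⟨hfF _, le_of_eq_of_le ?_ hn.le⟩
    apply integral_congr_ae
    filter_upwards [hfu (ns n)] with x hx
    rw [hx]
  exact ⟨l, hlK, fun u' hu' => hJl.trans (csInf_le hvb ⟨u', hu', rfl⟩)⟩

end DirectMethod

theorem aestronglyMeasurable_comp_of_continuousOn {X Y : Type*} [MeasurableSpace X]
    {μ : Measure X} [TopologicalSpace Y] [NormalSpace Y] {s : Set Y} (hs : IsClosed s) {q : Y → ℝ}
    (hq : ContinuousOn q s) {u : X → Y} (hu : AEStronglyMeasurable u μ)
    (hus : ∀ᵐ x ∂μ, u x ∈ s) : AEStronglyMeasurable (fun x => q (u x)) μ := by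
  obtain ⟨h, hh⟩ := ContinuousMap.exists_restrict_eq hs ⟨s.domRestrict q, hq.domRestrict⟩
  refine (h.continuous.comp_aestronglyMeasurable hu).congr ?_
  filter_upwards [hus] with x hx
  exact congrArg (fun f : C(s, ℝ) => f ⟨u x, hx⟩) hh

section Mechanics

noncomputable local instance matFrobeniusTopology : TopologicalSpace Mat :=
  PseudoMetricSpace.toUniformSpace.toTopologicalSpace

theorem finner_eq_sum (A B : Mat) : finner A B = ∑ p : Fin 3 × Fin 3, A p.1 p.2 * B p.1 p.2 := by
  rw [finner, Matrix.trace, Fintype.sum_prod_type_right]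
  simp [Matrix.mul_apply]

theorem finner_comm (A B : Mat) : finner A B = finner B A := by
  simp [finner_eq_sum, mul_comm]

theorem finner_add_left (A A' B : Mat) : finner (A + A') B = finner A B + finner A' B := by
  simp [finner, Matrix.add_mul]

theorem finner_smul_left (c : ℝ) (A B : Mat) : finner (c • A) B = c * finner A B := by
  simp [finner]

theorem finner_sub_left (A A' B : Mat) : finner (A - A') B = finner A B - finner A' B := by
  simp [finner, Matrix.sub_mul]

theorem finner_add_right (A B B' : Mat) : finner A (B + B') = finner A B + finner A B' := by
  simp [finner, Matrix.mul_add]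

theorem finner_smul_right (c : ℝ) (A B : Mat) : finner A (c • B) = c * finner A B := by
  simp [finner]

theorem finner_sub_right (A B B' : Mat) : finner A (B - B') = finner A B - finner A B' := by
  simp [finner, Matrix.mul_sub]

theorem norm_sq_eq_sum (A : Mat) : ‖A‖ ^ 2 = ∑ p : Fin 3 × Fin 3, A p.1 p.2 ^ 2 := by
  rw [Matrix.frobenius_norm_def, ← Real.sqrt_eq_rpow, Real.sq_sqrt (by positivity),
    Fintype.sum_prod_type]
  simp

theorem abs_finner_le (A B : Mat) : |finner A B| ≤ ‖A‖ * ‖B‖ := by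
  apply abs_le_of_sq_le_sq _ (by positivity)
  rw [mul_pow, norm_sq_eq_sum, norm_sq_eq_sum, finner_eq_sum]
  exact Finset.sum_mul_sq_le_sq_mul_sq _ _ _

theorem continuous_finner : Continuous fun p : Mat × Mat => finner p.1 p.2 := by
  unfold finner
  exact (continuous_fst.matrix_transpose.matrix_mul continuous_snd).matrix_trace

theorem continuousOn_finner {Y : Type*} [TopologicalSpace Y] {s : Set Y} {f h : Y → Mat}
    (hf : ContinuousOn f s) (hh : ContinuousOn h s) :
    ContinuousOn (fun y => finner (f y) (h y)) s := by
  have := continuous_finner.comp_continuousOn (hf.prodMk hh)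
  exact this

theorem isClosed_isSymm : IsClosed {A : Mat | A.IsSymm} :=
  isClosed_eq continuous_id.matrix_transpose continuous_id

theorem isClosed_isM : IsClosed {A : Mat | IsM A} :=
  isClosed_isSymm.inter (isClosed_eq continuous_id.matrix_trace continuous_const)

theorem IsM.smul {A : Mat} (hA : IsM A) (c : ℝ) : IsM (c • A) :=
  ⟨hA.1.smul c, by rw [Matrix.trace_smul, hA.2, smul_zero]⟩

theorem IsM.add {A B : Mat} (hA : IsM A) (hB : IsM B) : IsM (A + B) :=
  ⟨hA.1.add hB.1, by rw [Matrix.trace_add, hA.2, hB.2, add_zero]⟩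

/-- A positive continuous function is bounded below on the unit sphere of a closed set. -/
theorem exists_pos_le_on_sphere {S : Set Mat} (hS : IsClosed S) {q : Mat → ℝ}
    (hq : Continuous q) (hpos : ∀ A ∈ S, A ≠ 0 → 0 < q A) :
    ∃ c > 0, ∀ A ∈ S, ‖A‖ = 1 → c ≤ q A := by
  have hc : IsCompact (Metric.sphere (0 : Mat) 1 ∩ S) := (isCompact_sphere 0 1).inter_right hS
  rcases (Metric.sphere (0 : Mat) 1 ∩ S).eq_empty_or_nonempty with he | hne
  · refine ⟨1, one_pos, fun A hA hn => ?_⟩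
    have : A ∈ Metric.sphere (0 : Mat) 1 ∩ S := ⟨by simpa using hn, hA⟩
    simp [he] at this
  · obtain ⟨A, ⟨hA1, hA2⟩, hmin⟩ := hc.exists_isMinOn hne hq.continuousOn
    refine ⟨q A, hpos A hA2 ?_, fun B hB hn => hmin ⟨by simpa using hn, hB⟩⟩
    rintro rfl
    simp at hA1

theorem exists_norm_le_gauge {g : Mat → ℝ}
    (hghom : ∀ A : Mat, IsM A → ∀ l : ℝ, 0 ≤ l → g (l • A) = l * g A) (hgcont : Continuous g)
    (hgpos : ∀ A : Mat, IsM A → A ≠ 0 → 0 < g A) :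
    ∃ c, 0 ≤ c ∧ ∀ A, IsM A → ‖A‖ ≤ c * g A := by
  obtain ⟨c, hc, h⟩ := exists_pos_le_on_sphere isClosed_isM hgcont hgpos
  refine ⟨c⁻¹, by positivity, fun A hA => ?_⟩
  rcases eq_or_ne A 0 with rfl | hA0
  · have := hghom 0 hA 0 le_rfl
    rw [zero_smul, zero_mul] at this
    simp [this]
  · have hn : 0 < ‖A‖ := norm_pos_iff.2 hA0
    have h1 := h (‖A‖⁻¹ • A) (hA.smul _) (by rw [norm_smul, norm_inv, norm_norm]; field_simp)
    rw [hghom A hA _ (by positivity)] at h1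
    rw [inv_mul_eq_div, le_div_iff₀ hc]
    rw [inv_mul_eq_div, le_div_iff₀ hn] at h1
    linarith

theorem exists_coercive {S : Mat →ₗ[ℝ] Mat}
    (hS : ∀ A : Mat, A.IsSymm → A ≠ 0 → 0 < finner (S A) A) :
    ∃ c > 0, ∀ A : Mat, A.IsSymm → c * ‖A‖ ^ 2 ≤ finner (S A) A := by
  have hSc : Continuous S := S.continuous_of_finiteDimensional
  obtain ⟨c, hc, h⟩ := exists_pos_le_on_sphere (q := fun A => finner (S A) A) isClosed_isSymm
    (continuous_finner.comp (hSc.prodMk continuous_id)) hS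
  refine ⟨c, hc, fun A hA => ?_⟩
  rcases eq_or_ne A 0 with rfl | hA0
  · simp [finner]
  · have hn : 0 < ‖A‖ := norm_pos_iff.2 hA0
    have h1 := h (‖A‖⁻¹ • A) (hA.smul _) (by rw [norm_smul, norm_inv, norm_norm]; field_simp)
    rw [map_smul, finner_smul_left, finner_smul_right] at h1
    field_simp at h1
    exact h1

section Stiffness

variable {SA SM : Mat →ₗ[ℝ] Mat} {Cst : ℝ → Mat →ₗ[ℝ] Mat}

theorem exists_coercive_mixture
    (hSApos : ∀ A : Mat, A.IsSymm → A ≠ 0 → 0 < finner (SA A) A)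
    (hSMpos : ∀ A : Mat, A.IsSymm → A ≠ 0 → 0 < finner (SM A) A) :
    ∃ c > 0, ∀ ξ ∈ Set.Icc (0 : ℝ) 1, ∀ A : Mat, A.IsSymm →
      c * ‖A‖ ^ 2 ≤ finner ((ξ • SM + (1 - ξ) • SA) A) A := by
  obtain ⟨a, ha, hA⟩ := exists_coercive hSApos
  obtain ⟨m, hm, hM⟩ := exists_coercive hSMpos
  refine ⟨min a m, lt_min ha hm, fun ξ hξ A hAs => ?_⟩
  have h1 : min a m * ‖A‖ ^ 2 ≤ finner (SA A) A :=
    (mul_le_mul_of_nonneg_right (min_le_left _ _) (sq_nonneg _)).trans (hA A hAs)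
  have h2 : min a m * ‖A‖ ^ 2 ≤ finner (SM A) A :=
    (mul_le_mul_of_nonneg_right (min_le_right _ _) (sq_nonneg _)).trans (hM A hAs)
  simp only [LinearMap.add_apply, LinearMap.smul_apply, finner_add_left, finner_smul_left]
  nlinarith [mul_le_mul_of_nonneg_left h1 (sub_nonneg.2 hξ.2), mul_le_mul_of_nonneg_left h2 hξ.1]

/-- The elastic energy is a supremum of functions affine in the compliance and the strain. -/
theorem two_mul_finner_sub_le
    (hSAsym : ∀ A B : Mat, A.IsSymm → B.IsSymm → finner (SA A) B = finner A (SA B))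
    (hSMsym : ∀ A B : Mat, A.IsSymm → B.IsSymm → finner (SM A) B = finner A (SM B))
    (hSApos : ∀ A : Mat, A.IsSymm → A ≠ 0 → 0 < finner (SA A) A)
    (hSMpos : ∀ A : Mat, A.IsSymm → A ≠ 0 → 0 < finner (SM A) A)
    {ξ : ℝ} (hξ : ξ ∈ Set.Icc (0 : ℝ) 1)
    {p y z : Mat} (hp : p.IsSymm) (hpz : (ξ • SM + (1 - ξ) • SA) p = z) (hy : y.IsSymm) :
    2 * finner y z - finner ((ξ • SM + (1 - ξ) • SA) y) y ≤ finner p z := by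
  obtain ⟨c, hc, h⟩ := exists_coercive_mixture hSApos hSMpos
  have h1 : 0 ≤ finner ((ξ • SM + (1 - ξ) • SA) (p - y)) (p - y) :=
    (by positivity : 0 ≤ c * ‖p - y‖ ^ 2).trans (h ξ hξ _ (hp.sub hy))
  have h2 : finner ((ξ • SM + (1 - ξ) • SA) y) p = finner y z := by
    rw [← hpz]
    simp only [LinearMap.add_apply, LinearMap.smul_apply, finner_add_left, finner_smul_left,
      finner_add_right, finner_smul_right, hSAsym y p hy hp, hSMsym y p hy hp]
  rw [map_sub, hpz, finner_sub_right, finner_sub_left, finner_sub_left, h2, finner_comm z p,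
    finner_comm z y] at h1
  linarith

theorem convexOn_elastic
    (hSAsym : ∀ A B : Mat, A.IsSymm → B.IsSymm → finner (SA A) B = finner A (SA B))
    (hSMsym : ∀ A B : Mat, A.IsSymm → B.IsSymm → finner (SM A) B = finner A (SM B))
    (hSApos : ∀ A : Mat, A.IsSymm → A ≠ 0 → 0 < finner (SA A) A)
    (hSMpos : ∀ A : Mat, A.IsSymm → A ≠ 0 → 0 < finner (SM A) A)
    (hCstmap : ∀ ξ ∈ Set.Icc (0 : ℝ) 1, ∀ A : Mat, A.IsSymm → (Cst ξ A).IsSymm)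
    (hCstinv : ∀ ξ ∈ Set.Icc (0 : ℝ) 1, ∀ A : Mat, A.IsSymm →
      (ξ • SM + (1 - ξ) • SA) (Cst ξ A) = A ∧ Cst ξ ((ξ • SM + (1 - ξ) • SA) A) = A) :
    ConvexOn ℝ (Set.Icc (0 : ℝ) 1 ×ˢ {A : Mat | A.IsSymm})
      (fun p : ℝ × Mat => finner (Cst p.1 p.2) p.2) := by
  have hconv : Convex ℝ (Set.Icc (0 : ℝ) 1 ×ˢ {A : Mat | A.IsSymm}) :=
    (convex_Icc 0 1).prod fun A hA B hB a b _ _ _ => (hA.smul a).add (hB.smul b)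
  refine ⟨hconv, ?_⟩
  rintro ⟨s, A⟩ hsA ⟨t, B⟩ htB a b ha hb hab
  obtain ⟨hξ, hz⟩ := hconv hsA htB ha hb hab
  simp only [Prod.fst_add, Prod.smul_fst, Prod.snd_add, Prod.smul_snd, smul_eq_mul] at hξ hz ⊢
  set y := Cst (a * s + b * t) (a • A + b • B) with hy
  have hys : y.IsSymm := hCstmap _ hξ _ hz
  have hAy := (hCstinv _ hξ _ hz).1
  rw [← hy] at hAy
  have h1 := two_mul_finner_sub_le hSAsym hSMsym hSApos hSMpos hsA.1
    (hCstmap _ hsA.1 _ hsA.2) (hCstinv _ hsA.1 _ hsA.2).1 hys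
  have h2 := two_mul_finner_sub_le hSAsym hSMsym hSApos hSMpos htB.1
    (hCstmap _ htB.1 _ htB.2) (hCstinv _ htB.1 _ htB.2).1 hys
  have h3 : finner ((((a * s + b * t) • SM + (1 - (a * s + b * t)) • SA)) y) y =
      finner y (a • A + b • B) := by
    rw [hAy, finner_comm]
  have hb' : b = 1 - a := by linarith
  simp only [LinearMap.add_apply, LinearMap.smul_apply, finner_add_left, finner_smul_left,
    finner_add_right, finner_smul_right] at h1 h2 h3 ⊢
  have h4 := mul_le_mul_of_nonneg_left h1 ha
  have h5 := mul_le_mul_of_nonneg_left h2 hb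
  subst hb'
  linarith

theorem norm_stiffness_le {c : ℝ} (hc : 0 < c)
    (hcoer : ∀ ξ ∈ Set.Icc (0 : ℝ) 1, ∀ A : Mat, A.IsSymm →
      c * ‖A‖ ^ 2 ≤ finner ((ξ • SM + (1 - ξ) • SA) A) A)
    {ξ : ℝ} (hξ : ξ ∈ Set.Icc (0 : ℝ) 1) {p : Mat} (hp : p.IsSymm) :
    ‖p‖ ≤ c⁻¹ * ‖(ξ • SM + (1 - ξ) • SA) p‖ := by
  rcases eq_or_ne p 0 with rfl | h0
  · simp
  · have hn : 0 < ‖p‖ := norm_pos_iff.2 h0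
    have h1 := (hcoer ξ hξ p hp).trans ((le_abs_self _).trans (abs_finner_le _ _))
    rw [inv_mul_eq_div, le_div_iff₀ hc]
    have h2 : (c * ‖p‖) * ‖p‖ ≤ ‖(ξ • SM + (1 - ξ) • SA) p‖ * ‖p‖ := by linarith
    linarith [le_of_mul_le_mul_right h2 hn]

theorem continuousOn_elastic
    (hSApos : ∀ A : Mat, A.IsSymm → A ≠ 0 → 0 < finner (SA A) A)
    (hSMpos : ∀ A : Mat, A.IsSymm → A ≠ 0 → 0 < finner (SM A) A)
    (hCstmap : ∀ ξ ∈ Set.Icc (0 : ℝ) 1, ∀ A : Mat, A.IsSymm → (Cst ξ A).IsSymm)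
    (hCstinv : ∀ ξ ∈ Set.Icc (0 : ℝ) 1, ∀ A : Mat, A.IsSymm →
      (ξ • SM + (1 - ξ) • SA) (Cst ξ A) = A ∧ Cst ξ ((ξ • SM + (1 - ξ) • SA) A) = A) :
    ContinuousOn (fun p : ℝ × Mat => finner (Cst p.1 p.2) p.2)
      (Set.Icc (0 : ℝ) 1 ×ˢ {A : Mat | A.IsSymm}) := by
  obtain ⟨c, hc, hcoer⟩ := exists_coercive_mixture hSApos hSMpos
  suffices h : ContinuousOn (fun p : ℝ × Mat => Cst p.1 p.2)
      (Set.Icc (0 : ℝ) 1 ×ˢ {A : Mat | A.IsSymm}) from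
    continuousOn_finner h continuousOn_snd
  rintro ⟨t, B⟩ ⟨ht, hB⟩
  have hlim : Tendsto (fun p : ℝ × Mat => c⁻¹ * ‖(p.2 - B) - (p.1 - t) • (SM - SA) (Cst t B)‖)
      (𝓝[Set.Icc (0 : ℝ) 1 ×ˢ {A : Mat | A.IsSymm}] (t, B)) (𝓝 0) := by
    have hcont : Continuous
        (fun p : ℝ × Mat => c⁻¹ * ‖(p.2 - B) - (p.1 - t) • (SM - SA) (Cst t B)‖) := by
      fun_prop
    have := hcont.tendsto (t, B)
    simp only [sub_self, zero_smul, norm_zero, mul_zero] at this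
    exact this.mono_left nhdsWithin_le_nhds
  rw [ContinuousWithinAt, tendsto_iff_norm_sub_tendsto_zero]
  refine squeeze_zero' (Eventually.of_forall fun _ => norm_nonneg _) ?_ hlim
  filter_upwards [self_mem_nhdsWithin] with p hp
  obtain ⟨hs, hA⟩ := hp
  dsimp only at ht hB
  have h1 := norm_stiffness_le hc hcoer hs ((hCstmap _ hs _ hA).sub (hCstmap _ ht _ hB))
  have h2 := (hCstinv _ hs _ hA).1
  have h3 := (hCstinv _ ht _ hB).1
  refine h1.trans_eq ?_
  rw [map_sub, h2]
  congr 2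
  generalize Cst t B = y at h3 ⊢
  rw [← h3]
  simp only [LinearMap.add_apply, LinearMap.smul_apply, LinearMap.sub_apply]
  module

end Stiffness

/-- The pointwise constraint set of `Adm`. -/
def admissibleValues (g : Mat → ℝ) : Set (ℝ × Mat) :=
  {p | 0 ≤ p.1 ∧ p.1 ≤ 1 ∧ IsM p.2 ∧ g p.2 ≤ p.1}

theorem isFieldIn_admissibleValues_iff {Ω : Set E3} {g : Mat → ℝ} {u : E3 → ℝ × Mat} :
    IsFieldIn (volume.restrict Ω) (admissibleValues g) u ↔
      Adm Ω g (fun x => (u x).1) (fun x => (u x).2) :=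
  ⟨fun h => ⟨continuous_fst.comp_aestronglyMeasurable h.1,
    continuous_snd.comp_aestronglyMeasurable h.1, h.2⟩,
    fun h => ⟨AEStronglyMeasurable.prodMk h.1 h.2.1, h.2.2⟩⟩

section AdmissibleValues

variable {g : Mat → ℝ} {c : ℝ}

theorem convex_admissibleValues (hgconv : ConvexOn ℝ {A : Mat | IsM A} g) :
    Convex ℝ (admissibleValues g) := by
  rintro ⟨s, A⟩ ⟨h1, h2, h3, h4⟩ ⟨t, B⟩ ⟨k1, k2, k3, k4⟩ a b ha hb hab
  dsimp only at h1 h2 h3 h4 k1 k2 k3 k4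
  refine ⟨by simp only [Prod.fst_add, Prod.smul_fst, smul_eq_mul]; positivity, ?_,
    (h3.smul a).add (k3.smul b), ?_⟩
  · simp only [Prod.fst_add, Prod.smul_fst, smul_eq_mul]
    nlinarith
  · refine (hgconv.2 h3 k3 ha hb hab).trans ?_
    simp only [Prod.fst_add, Prod.smul_fst, smul_eq_mul]
    gcongr

theorem norm_le_of_mem_admissibleValues (hc0 : 0 ≤ c) (hc : ∀ A, IsM A → ‖A‖ ≤ c * g A)
    {p : ℝ × Mat} (hp : p ∈ admissibleValues g) : ‖p.2‖ ≤ c * p.1 :=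
  (hc _ hp.2.2.1).trans (mul_le_mul_of_nonneg_left hp.2.2.2 hc0)

theorem isCompact_admissibleValues (hgcont : Continuous g) (hc0 : 0 ≤ c)
    (hc : ∀ A, IsM A → ‖A‖ ≤ c * g A) : IsCompact (admissibleValues g) := by
  have hcl : IsClosed (admissibleValues g) :=
    (isClosed_le continuous_const continuous_fst).inter
      ((isClosed_le continuous_fst continuous_const).inter
        ((isClosed_isM.preimage continuous_snd).inter
          (isClosed_le (hgcont.comp continuous_snd) continuous_fst)))
  refine ((isCompact_Icc (a := (0 : ℝ)) (b := 1)).prod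
    (isCompact_closedBall (0 : Mat) c)).of_isClosed_subset hcl fun p hp => ⟨⟨hp.1, hp.2.1⟩, ?_⟩
  rw [mem_closedBall_zero_iff]
  exact (norm_le_of_mem_admissibleValues hc0 hc hp).trans (mul_le_of_le_one_right hc0 hp.2.1)

theorem r1_eq_div {ξ : ℝ} (hξ : 0 ≤ ξ) (A b : Mat) : r1 ξ A b = ‖A - ξ • b‖ ^ 2 / ξ := by
  rcases hξ.eq_or_lt with rfl | h
  · simp [r1]
  · simp [r1, h]

theorem r1_nonneg (ξ : ℝ) (A b : Mat) : 0 ≤ r1 ξ A b := by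
  unfold r1
  split_ifs <;> positivity

theorem norm_sub_smul_le (hc0 : 0 ≤ c) (hc : ∀ A, IsM A → ‖A‖ ≤ c * g A)
    {p : ℝ × Mat} (hp : p ∈ admissibleValues g) (w : Mat) :
    ‖p.2 - p.1 • w‖ ≤ (c + ‖w‖) * p.1 := by
  have h1 := norm_le_of_mem_admissibleValues hc0 hc hp
  have h2 : ‖p.1 • w‖ = p.1 * ‖w‖ := by rw [norm_smul, Real.norm_of_nonneg hp.1]
  linarith [norm_sub_le p.2 (p.1 • w)]

theorem r1_le (hc0 : 0 ≤ c) (hc : ∀ A, IsM A → ‖A‖ ≤ c * g A)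
    {p : ℝ × Mat} (hp : p ∈ admissibleValues g) (w : Mat) :
    r1 p.1 p.2 w ≤ (c + ‖w‖) ^ 2 * p.1 := by
  rw [r1_eq_div hp.1]
  rcases hp.1.eq_or_lt with h | h
  · simp [← h]
  · rw [div_le_iff₀ h]
    calc ‖p.2 - p.1 • w‖ ^ 2 ≤ ((c + ‖w‖) * p.1) ^ 2 := by
          gcongr
          exact norm_sub_smul_le hc0 hc hp w
      _ = (c + ‖w‖) ^ 2 * p.1 * p.1 := by ring

theorem exists_r1_eq (hc0 : 0 ≤ c) (hc : ∀ A, IsM A → ‖A‖ ≤ c * g A)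
    {p : ℝ × Mat} (hp : p ∈ admissibleValues g) (w : Mat) :
    ∃ m : ℝ, ‖p.2 - p.1 • w‖ = m * p.1 ∧ r1 p.1 p.2 w = m ^ 2 * p.1 := by
  rw [r1_eq_div hp.1]
  have hn := norm_sub_smul_le hc0 hc hp w
  rcases hp.1.eq_or_lt with h | h
  · refine ⟨0, ?_, by simp [← h]⟩
    rw [← h, mul_zero] at hn
    rw [← h, zero_mul]
    exact le_antisymm hn (norm_nonneg _)
  · refine ⟨‖p.2 - p.1 • w‖ / p.1, by field_simp, by field_simp⟩

theorem convexOn_r1 (hgconv : ConvexOn ℝ {A : Mat | IsM A} g) (hc0 : 0 ≤ c)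
    (hc : ∀ A, IsM A → ‖A‖ ≤ c * g A) (w : Mat) :
    ConvexOn ℝ (admissibleValues g) (fun p => r1 p.1 p.2 w) := by
  refine ⟨convex_admissibleValues hgconv, fun p hp q hq a b ha hb hab => ?_⟩
  have hpq := convex_admissibleValues hgconv hp hq ha hb hab
  obtain ⟨m, hm, hrm⟩ := exists_r1_eq hc0 hc hp w
  obtain ⟨n, hn, hrn⟩ := exists_r1_eq hc0 hc hq w
  have hN : ‖(a • p + b • q).2 - (a • p + b • q).1 • w‖ ≤ a * (m * p.1) + b * (n * q.1) := by
    have h : (a • p + b • q).2 - (a • p + b • q).1 • w =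
        a • (p.2 - p.1 • w) + b • (q.2 - q.1 • w) := by
      simp only [Prod.fst_add, Prod.smul_fst, Prod.snd_add, Prod.smul_snd, smul_eq_mul]
      module
    rw [h, ← hm, ← hn]
    refine (norm_add_le _ _).trans_eq ?_
    rw [norm_smul, norm_smul, Real.norm_of_nonneg ha, Real.norm_of_nonneg hb]
  have hS : (a • p + b • q).1 = a * p.1 + b * q.1 := rfl
  have hp1 := hp.1
  have hq1 := hq.1
  simp only [hrm, hrn, smul_eq_mul]
  rw [r1_eq_div hpq.1]
  rcases hpq.1.eq_or_lt with h | h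
  · rw [← h, div_zero]
    positivity
  · rw [div_le_iff₀ h]
    refine (pow_le_pow_left₀ (norm_nonneg _) hN 2).trans ?_
    rw [hS]
    have : 0 ≤ (a * p.1) * (b * q.1) * (m - n) ^ 2 := by positivity
    linarith

theorem continuousOn_r1 (hc0 : 0 ≤ c) (hc : ∀ A, IsM A → ‖A‖ ≤ c * g A) :
    ContinuousOn (fun z : (ℝ × Mat) × Mat => r1 z.1.1 z.1.2 z.2)
      (admissibleValues g ×ˢ Set.univ) := by
  rintro ⟨p, w⟩ ⟨hp, -⟩
  dsimp only at hp
  rcases hp.1.eq_or_lt with h | h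
  · have h0 : r1 p.1 p.2 w = 0 := by simp [r1, ← h]
    rw [ContinuousWithinAt]
    simp only [h0]
    have hlim : Tendsto (fun z : (ℝ × Mat) × Mat => (c + ‖z.2‖) ^ 2 * z.1.1)
        (𝓝[admissibleValues g ×ˢ Set.univ] (p, w)) (𝓝 0) := by
      have hcont : Continuous (fun z : (ℝ × Mat) × Mat => (c + ‖z.2‖) ^ 2 * z.1.1) := by
        fun_prop
      have := hcont.tendsto (p, w)
      simp only [← h, mul_zero] at this
      exact this.mono_left nhdsWithin_le_nhds
    refine squeeze_zero' (Eventually.of_forall fun _ => r1_nonneg _ _ _) ?_ hlim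
    filter_upwards [self_mem_nhdsWithin] with z hz using r1_le hc0 hc hz.1 _
  · have hdiv : ContinuousWithinAt
        (fun z : (ℝ × Mat) × Mat => ‖z.1.2 - z.1.1 • z.2‖ ^ 2 / z.1.1)
        (admissibleValues g ×ˢ Set.univ) (p, w) := by
      apply ContinuousWithinAt.div
      · exact Continuous.continuousWithinAt (by fun_prop)
      · exact Continuous.continuousWithinAt (by fun_prop)
      · exact h.ne'
    exact hdiv.congr (fun z hz => r1_eq_div hz.1.1 _ _) (r1_eq_div hp.1 _ _)

end AdmissibleValues

/-- The dissipation increment as a function of the new state `p`, with coefficients `c₁`, `c₂` of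
the forward and reverse branches and previous state `(ξ₀, E₀)`, `P` being `E₀ / ξ₀`. -/
noncomputable def dissipation (c₁ c₂ σ ξ₀ : ℝ) (E₀ P : Mat) (p : ℝ × Mat) : ℝ :=
  c₁ * max (p.1 - ξ₀) 0 + c₂ * max (ξ₀ - p.1) 0 +
    σ * (max (ξ₀ - p.1) 0 * ‖P‖ + ‖p.2 - E₀ + max (ξ₀ - p.1) 0 • P‖)

theorem dT_eq_dissipation (ΔsAM σreo T0 Ms Mf As Af ξ₀ : ℝ) (E₀ : Mat) (p : ℝ × Mat) :
    dT ΔsAM σreo T0 Ms Mf As Af E₀ ξ₀ (p.2 - E₀) (p.1 - ξ₀) =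
      dissipation (ΔsAM * (T0 - Ms + ξ₀ * (Ms - Mf))) (ΔsAM * (Af - T0 + ξ₀ * (As - Af)))
        σreo ξ₀ E₀ (ξ₀⁻¹ • E₀) p := by
  unfold dT dissipation
  split_ifs with h
  · rw [max_eq_left h, max_eq_right (by linarith), abs_of_nonneg h]
    simp
  · rw [not_le] at h
    rw [max_eq_right h.le, max_eq_left (by linarith), abs_of_neg h]
    have h1 : ((p.1 - ξ₀) / ξ₀) • E₀ = -((ξ₀ - p.1) • (ξ₀⁻¹ • E₀)) := by
      rw [smul_smul, ← neg_smul]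
      congr 1
      ring
    have h2 : (ξ₀ - p.1) * ‖ξ₀⁻¹ • E₀‖ = ‖(ξ₀ - p.1) • (ξ₀⁻¹ • E₀)‖ := by
      rw [norm_smul (ξ₀ - p.1), Real.norm_of_nonneg (by linarith)]
    rw [h1, h2, norm_neg, sub_neg_eq_add]
    ring

theorem convexOn_dissipation {c₁ c₂ σ : ℝ} (h₁ : 0 ≤ c₁) (h₂ : 0 ≤ c₂) (hσ : 0 ≤ σ) (ξ₀ : ℝ)
    (E₀ P : Mat) : ConvexOn ℝ Set.univ (dissipation c₁ c₂ σ ξ₀ E₀ P) := by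
  refine ⟨convex_univ, fun p _ q _ a b ha hb hab => ?_⟩
  have hb' : b = 1 - a := by linarith
  have hpos : ∀ s t : ℝ, max (a * s + b * t) 0 ≤ a * max s 0 + b * max t 0 := fun s t => by
    apply max_le
    · gcongr <;> exact le_max_left _ _
    · positivity
  have hf : max ((a • p + b • q).1 - ξ₀) 0 ≤ a * max (p.1 - ξ₀) 0 + b * max (q.1 - ξ₀) 0 := by
    refine le_of_eq_of_le ?_ (hpos _ _)
    simp only [Prod.fst_add, Prod.smul_fst, smul_eq_mul, hb']
    congr 1
    ring
  have hr : max (ξ₀ - (a • p + b • q).1) 0 ≤ a * max (ξ₀ - p.1) 0 + b * max (ξ₀ - q.1) 0 := by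
    refine le_of_eq_of_le ?_ (hpos _ _)
    simp only [Prod.fst_add, Prod.smul_fst, smul_eq_mul, hb']
    congr 1
    ring
  simp only [dissipation, smul_eq_mul]
  set S := max (ξ₀ - (a • p + b • q).1) 0
  set s := max (ξ₀ - p.1) 0
  set t := max (ξ₀ - q.1) 0
  have hN : ‖(a • p + b • q).2 - E₀ + S • P‖ ≤
      a * ‖p.2 - E₀ + s • P‖ + b * ‖q.2 - E₀ + t • P‖ + (a * s + b * t - S) * ‖P‖ := by
    have h : (a • p + b • q).2 - E₀ + S • P =
        a • (p.2 - E₀ + s • P) + b • (q.2 - E₀ + t • P) - (a * s + b * t - S) • P := by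
      simp only [Prod.snd_add, Prod.smul_snd, hb']
      module
    rw [h]
    refine (norm_sub_le _ _).trans (add_le_add ((norm_add_le _ _).trans_eq ?_) (le_of_eq ?_))
    · rw [norm_smul, norm_smul, Real.norm_of_nonneg ha, Real.norm_of_nonneg hb]
    · rw [norm_smul, Real.norm_of_nonneg (by linarith)]
  have k1 := mul_le_mul_of_nonneg_left hf h₁
  have k2 := mul_le_mul_of_nonneg_left hr h₂
  have k3 := mul_le_mul_of_nonneg_left hN hσ
  linarith

theorem continuous_dissipation (σ : ℝ) :
    Continuous fun z : (ℝ × ℝ × ℝ) × Mat × Mat × ℝ × Mat =>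
      dissipation z.1.1 z.1.2.1 σ z.1.2.2 z.2.1 z.2.2.1 z.2.2.2 := by
  unfold dissipation
  fun_prop

theorem abs_dissipation_le {c₁ c₂ σ ξ₀ C₁ C₂ r : ℝ} {E₀ P : Mat} {p : ℝ × Mat}
    (h₁ : 0 ≤ c₁) (h₂ : 0 ≤ c₂) (hσ : 0 ≤ σ) (hC₁ : c₁ ≤ C₁) (hC₂ : c₂ ≤ C₂)
    (hξ : |p.1 - ξ₀| ≤ 1) (hE₀ : ‖E₀‖ ≤ r) (hP : ‖P‖ ≤ r) (hp : ‖p.2‖ ≤ r) :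
    |dissipation c₁ c₂ σ ξ₀ E₀ P p| ≤ C₁ + C₂ + σ * (4 * r) := by
  obtain ⟨hξ1, hξ2⟩ := abs_le.1 hξ
  have hf0 : 0 ≤ max (p.1 - ξ₀) 0 := le_max_right _ _
  have hr0 : 0 ≤ max (ξ₀ - p.1) 0 := le_max_right _ _
  have hf1 : max (p.1 - ξ₀) 0 ≤ 1 := max_le hξ2 zero_le_one
  have hr1 : max (ξ₀ - p.1) 0 ≤ 1 := max_le (by linarith) zero_le_one
  unfold dissipation
  rw [abs_of_nonneg (by positivity)]
  have hr : 0 ≤ r := (norm_nonneg _).trans hP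
  have k1 : c₁ * max (p.1 - ξ₀) 0 ≤ C₁ := (mul_le_of_le_one_right h₁ hf1).trans hC₁
  have k2 : c₂ * max (ξ₀ - p.1) 0 ≤ C₂ := (mul_le_of_le_one_right h₂ hr1).trans hC₂
  have k3 : max (ξ₀ - p.1) 0 * ‖P‖ ≤ r := (mul_le_of_le_one_left (norm_nonneg _) hr1).trans hP
  have k4 : ‖max (ξ₀ - p.1) 0 • P‖ ≤ r := by
    rwa [norm_smul, Real.norm_of_nonneg hr0]
  have k5 : ‖p.2 - E₀ + max (ξ₀ - p.1) 0 • P‖ ≤ r + r + r :=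
    (norm_add_le _ _).trans (add_le_add ((norm_sub_le _ _).trans (add_le_add hp hE₀)) k4)
  have k6 := mul_le_mul_of_nonneg_left (add_le_add k3 k5) hσ
  linarith

theorem continuous_gaussK (ω : ℝ) : Continuous (gaussK ω) := by
  unfold gaussK
  fun_prop

theorem gaussK_nonneg {ω : ℝ} (hω : 0 < ω) (z : E3) : 0 ≤ gaussK ω z := by
  unfold gaussK
  positivity

theorem gaussK_le {ω : ℝ} (hω : 0 < ω) (z : E3) :
    gaussK ω z ≤ (2 * Real.pi) ^ (-(3 : ℝ) / 2) * ω ^ (-(3 : ℝ)) := by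
  unfold gaussK
  refine mul_le_of_le_one_right (by positivity) (Real.exp_le_one_iff.2 ?_)
  exact div_nonpos_of_nonpos_of_nonneg (by simp) (by positivity)

section NonlocalAverage

variable {Ω : Set E3} {ω : ℝ}

/-- The normalised kernel of the nonlocal average. -/
noncomputable def avgKernel (Ω : Set E3) (ω : ℝ) (x y : E3) : ℝ :=
  (∫ z in Ω, gaussK ω (x - z))⁻¹ * gaussK ω (x - y)

theorem nlAvgM_eq_integral_avgKernel (f : E3 → Mat) (x : E3) :
    nlAvgM Ω ω f x = ∫ y in Ω, avgKernel Ω ω x y • f y := by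
  simp only [nlAvgM, avgKernel, mul_smul]
  rw [integral_smul]

theorem memLp_avgKernel (hω : 0 < ω) [IsFiniteMeasure (volume.restrict Ω)] (x : E3) :
    MemLp (avgKernel Ω ω x) 2 (volume.restrict Ω) := by
  have hm : Continuous fun y => gaussK ω (x - y) :=
    (continuous_gaussK ω).comp (continuous_const.sub continuous_id)
  refine (MemLp.of_bound hm.aestronglyMeasurable
    ((2 * Real.pi) ^ (-(3 : ℝ) / 2) * ω ^ (-(3 : ℝ))) (ae_of_all _ fun y => ?_)).const_mul _
  rw [Real.norm_of_nonneg (gaussK_nonneg hω _)]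
  exact gaussK_le hω _

theorem aestronglyMeasurable_nlAvgM [IsFiniteMeasure (volume.restrict Ω)] {f : E3 → Mat}
    (hf : AEStronglyMeasurable f (volume.restrict Ω)) :
    AEStronglyMeasurable (nlAvgM Ω ω f) (volume.restrict Ω) := by
  have hk : Continuous fun p : E3 × E3 => gaussK ω (p.1 - p.2) :=
    (continuous_gaussK ω).comp (continuous_fst.sub continuous_snd)
  have h1 : AEStronglyMeasurable (fun x => ∫ y in Ω, gaussK ω (x - y)) (volume.restrict Ω) :=
    (hk.aestronglyMeasurable (μ := (volume.restrict Ω).prod (volume.restrict Ω))).integral_prod_right'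
  have h2 : AEStronglyMeasurable (fun x => ∫ y in Ω, gaussK ω (x - y) • f y)
      (volume.restrict Ω) :=
    (hk.aestronglyMeasurable (μ := (volume.restrict Ω).prod (volume.restrict Ω)).smul
      hf.comp_snd).integral_prod_right'
  exact h1.aemeasurable.inv.aestronglyMeasurable.smul h2

theorem norm_nlAvgM_le (hω : 0 < ω) [IsFiniteMeasure (volume.restrict Ω)] {f : E3 → Mat} {r : ℝ}
    (hr : 0 ≤ r) (hfr : ∀ᵐ y ∂volume.restrict Ω, ‖f y‖ ≤ r) (x : E3) : ‖nlAvgM Ω ω f x‖ ≤ r := by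
  have hm : Continuous fun y => gaussK ω (x - y) :=
    (continuous_gaussK ω).comp (continuous_const.sub continuous_id)
  have hInt : Integrable (fun y => gaussK ω (x - y)) (volume.restrict Ω) := by
    refine Integrable.of_bound hm.aestronglyMeasurable
      ((2 * Real.pi) ^ (-(3 : ℝ) / 2) * ω ^ (-(3 : ℝ))) (ae_of_all _ fun y => ?_)
    rw [Real.norm_of_nonneg (gaussK_nonneg hω _)]
    exact gaussK_le hω _
  have h1 : ‖∫ y in Ω, gaussK ω (x - y) • f y‖ ≤ (∫ y in Ω, gaussK ω (x - y)) * r := by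
    rw [← integral_mul_const]
    refine norm_integral_le_of_norm_le (hInt.mul_const r) ?_
    filter_upwards [hfr] with y hy
    rw [norm_smul, Real.norm_of_nonneg (gaussK_nonneg hω _)]
    exact mul_le_mul_of_nonneg_left hy (gaussK_nonneg hω _)
  have h0 : 0 ≤ ∫ y in Ω, gaussK ω (x - y) := integral_nonneg fun y => gaussK_nonneg hω _
  rw [nlAvgM, norm_smul, norm_inv, Real.norm_of_nonneg h0]
  rcases h0.eq_or_lt with h | h
  · simpa [← h] using hr
  · rw [inv_mul_eq_div, div_le_iff₀ h]
    linarith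

end NonlocalAverage

/-- The integrand of `ETot`. -/
noncomputable def energyDensity (lam CMA CAM : ℝ) (Cst : ℝ → Mat →ₗ[ℝ] Mat)
    (ΔsAM σreo T0 Ms Mf As Af : ℝ) (e₀ : Mat) (ξ₀ : ℝ) (E₀ : Mat) (p : ℝ × Mat) (w : Mat) : ℝ :=
  (1 / 2) * finner (Cst p.1 (e₀ - p.2)) (e₀ - p.2) + lam * p.1 + CMA * r1 p.1 p.2 w
    + CAM * (1 - p.1) * ‖w‖ ^ 2
    + dT ΔsAM σreo T0 Ms Mf As Af E₀ ξ₀ (p.2 - E₀) (p.1 - ξ₀)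

theorem dT_coefficients_bounds {ΔsAM T0 Ms Mf As Af ξ₀ : ℝ} (hΔs : 0 ≤ ΔsAM)
    (hT1 : Mf ≤ Ms) (hT2 : Ms ≤ T0) (hT3 : T0 ≤ As) (hT4 : As ≤ Af) (h0 : 0 ≤ ξ₀) (h1 : ξ₀ ≤ 1) :
    0 ≤ ΔsAM * (T0 - Ms + ξ₀ * (Ms - Mf)) ∧ 0 ≤ ΔsAM * (Af - T0 + ξ₀ * (As - Af)) ∧
      ΔsAM * (T0 - Ms + ξ₀ * (Ms - Mf)) ≤ ΔsAM * (T0 - Mf) ∧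
      ΔsAM * (Af - T0 + ξ₀ * (As - Af)) ≤ ΔsAM * (Af - T0) := by
  refine ⟨mul_nonneg hΔs ?_, mul_nonneg hΔs ?_, mul_le_mul_of_nonneg_left ?_ hΔs,
    mul_le_mul_of_nonneg_left ?_ hΔs⟩ <;> nlinarith

section EnergyDensity

variable {g : Mat → ℝ} {c : ℝ} {lam CMA CAM : ℝ} {SA SM : Mat →ₗ[ℝ] Mat}
  {Cst : ℝ → Mat →ₗ[ℝ] Mat} {ΔsAM σreo T0 Ms Mf As Af : ℝ}

theorem mapsTo_elastic_arguments {e₀ : Mat} (he₀ : e₀.IsSymm) :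
    Set.MapsTo (fun p : ℝ × Mat => (p.1, e₀ - p.2)) (admissibleValues g)
      (Set.Icc (0 : ℝ) 1 ×ˢ {A : Mat | A.IsSymm}) :=
  fun _ hp => ⟨⟨hp.1, hp.2.1⟩, he₀.sub hp.2.2.1.1⟩

theorem convexOn_energyDensity (hgconv : ConvexOn ℝ {A : Mat | IsM A} g) (hc0 : 0 ≤ c)
    (hc : ∀ A, IsM A → ‖A‖ ≤ c * g A) (hMA : 0 ≤ CMA)
    (hel : ConvexOn ℝ (Set.Icc (0 : ℝ) 1 ×ˢ {A : Mat | A.IsSymm})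
      (fun p : ℝ × Mat => finner (Cst p.1 p.2) p.2))
    (hΔs : 0 ≤ ΔsAM) (hσ : 0 ≤ σreo)
    (hT1 : Mf ≤ Ms) (hT2 : Ms ≤ T0) (hT3 : T0 ≤ As) (hT4 : As ≤ Af)
    {e₀ : Mat} (he₀ : e₀.IsSymm) {ξ₀ : ℝ} (h0 : 0 ≤ ξ₀) (h1 : ξ₀ ≤ 1) (E₀ w : Mat) :
    ConvexOn ℝ (admissibleValues g) (fun p =>
      energyDensity lam CMA CAM Cst ΔsAM σreo T0 Ms Mf As Af e₀ ξ₀ E₀ p w) := by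
  have hK := convex_admissibleValues hgconv
  obtain ⟨k1, k2, -, -⟩ := dT_coefficients_bounds hΔs hT1 hT2 hT3 hT4 h0 h1
  have hd := (convexOn_dissipation k1 k2 hσ ξ₀ E₀ (ξ₀⁻¹ • E₀)).subset
    (Set.subset_univ (admissibleValues g)) hK
  have hr := (convexOn_r1 hgconv hc0 hc w).smul hMA
  refine ⟨hK, fun p hp q hq a b ha hb hab => ?_⟩
  have e1 := hel.2 (mapsTo_elastic_arguments he₀ hp) (mapsTo_elastic_arguments he₀ hq) ha hb hab
  have e2 := hr.2 hp hq ha hb hab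
  have e3 := hd.2 hp hq ha hb hab
  have hz : e₀ - (a • p + b • q).2 = a • (e₀ - p.2) + b • (e₀ - q.2) := by
    have hb' : b = 1 - a := by linarith
    simp only [Prod.snd_add, Prod.smul_snd, hb']
    module
  have hs : (a • p + b • q).1 = a * p.1 + b * q.1 := rfl
  simp only [energyDensity, dT_eq_dissipation]
  simp only [Prod.fst_add, Prod.smul_fst, Prod.snd_add, Prod.smul_snd, smul_eq_mul] at e1 e2 e3 hz ⊢
  rw [hz]
  have hb' : b = 1 - a := by linarith
  subst hb'
  linarith

theorem continuousOn_energyDensity (hc0 : 0 ≤ c) (hc : ∀ A, IsM A → ‖A‖ ≤ c * g A)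
    (hel : ContinuousOn (fun p : ℝ × Mat => finner (Cst p.1 p.2) p.2)
      (Set.Icc (0 : ℝ) 1 ×ˢ {A : Mat | A.IsSymm}))
    {e₀ : Mat} (he₀ : e₀.IsSymm) (ξ₀ : ℝ) (E₀ : Mat) :
    ContinuousOn (fun z : (ℝ × Mat) × Mat =>
      energyDensity lam CMA CAM Cst ΔsAM σreo T0 Ms Mf As Af e₀ ξ₀ E₀ z.1 z.2)
      (admissibleValues g ×ˢ Set.univ) := by
  have he : ContinuousOn (fun z : (ℝ × Mat) × Mat => finner (Cst z.1.1 (e₀ - z.1.2)) (e₀ - z.1.2))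
      (admissibleValues g ×ˢ Set.univ) :=
    hel.comp (f := fun z : (ℝ × Mat) × Mat => (z.1.1, e₀ - z.1.2))
      (Continuous.continuousOn (by fun_prop))
      fun z hz => mapsTo_elastic_arguments he₀ hz.1
  have hd : Continuous fun z : (ℝ × Mat) × Mat =>
      dissipation (ΔsAM * (T0 - Ms + ξ₀ * (Ms - Mf))) (ΔsAM * (Af - T0 + ξ₀ * (As - Af)))
        σreo ξ₀ E₀ (ξ₀⁻¹ • E₀) z.1 :=
    (continuous_dissipation σreo).comp
      (f := fun z : (ℝ × Mat) × Mat => ((ΔsAM * (T0 - Ms + ξ₀ * (Ms - Mf)),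
        ΔsAM * (Af - T0 + ξ₀ * (As - Af)), ξ₀), E₀, ξ₀⁻¹ • E₀, z.1)) (by fun_prop)
  simp only [energyDensity, dT_eq_dissipation]
  refine ((((he.const_mul _).add ?_).add ((continuousOn_r1 hc0 hc).const_mul _)).add ?_).add
    hd.continuousOn
  · exact Continuous.continuousOn (by fun_prop)
  · exact Continuous.continuousOn (by fun_prop)

theorem aestronglyMeasurable_energyDensity {Ω : Set E3}
    (hel : ContinuousOn (fun p : ℝ × Mat => finner (Cst p.1 p.2) p.2)
      (Set.Icc (0 : ℝ) 1 ×ˢ {A : Mat | A.IsSymm}))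
    {e : E3 → Mat} (hesymm : ∀ x, (e x).IsSymm)
    (hemeas : AEStronglyMeasurable e (volume.restrict Ω))
    {ξ0 : E3 → ℝ} (hξ0 : AEStronglyMeasurable ξ0 (volume.restrict Ω))
    {E0 : E3 → Mat} (hE0 : AEStronglyMeasurable E0 (volume.restrict Ω))
    {u : E3 → ℝ × Mat} (hu : IsFieldIn (volume.restrict Ω) (admissibleValues g) u)
    {b : E3 → Mat} (hb : AEStronglyMeasurable b (volume.restrict Ω)) :
    AEStronglyMeasurable (fun x =>
      energyDensity lam CMA CAM Cst ΔsAM σreo T0 Ms Mf As Af (e x) (ξ0 x) (E0 x) (u x) (b x))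
      (volume.restrict Ω) := by
  have hu1 : AEStronglyMeasurable (fun x => (u x).1) (volume.restrict Ω) :=
    continuous_fst.comp_aestronglyMeasurable hu.1
  have hu2 : AEStronglyMeasurable (fun x => (u x).2) (volume.restrict Ω) :=
    continuous_snd.comp_aestronglyMeasurable hu.1
  have he : AEStronglyMeasurable
      (fun x => finner (Cst (u x).1 (e x - (u x).2)) (e x - (u x).2)) (volume.restrict Ω) := by
    have := aestronglyMeasurable_comp_of_continuousOn (isClosed_Icc.prod isClosed_isSymm) hel
      (hu1.prodMk (hemeas.sub hu2))
      (hu.2.mono fun x hx => mapsTo_elastic_arguments (hesymm x) hx)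
    exact this
  have hr : AEStronglyMeasurable (fun x => r1 (u x).1 (u x).2 (b x)) (volume.restrict Ω) := by
    have h1 : AEMeasurable (fun x => ‖(u x).2 - (u x).1 • b x‖ ^ 2) (volume.restrict Ω) :=
      ((hu2.sub (hu1.smul hb)).norm.pow 2).aemeasurable
    refine (h1.div hu1.aemeasurable).aestronglyMeasurable.congr ?_
    filter_upwards [hu.2] with x hx
    exact (r1_eq_div hx.1 _ _).symm
  have hn : AEStronglyMeasurable (fun x => CAM * (1 - (u x).1) * ‖b x‖ ^ 2) (volume.restrict Ω) :=
    ((aestronglyMeasurable_const.sub hu1).const_mul CAM).mul (hb.norm.pow 2)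
  have hP : AEStronglyMeasurable (fun x => (ξ0 x)⁻¹ • E0 x) (volume.restrict Ω) :=
    hξ0.aemeasurable.inv.aestronglyMeasurable.smul hE0
  have hc1 : AEStronglyMeasurable (fun x => ΔsAM * (T0 - Ms + ξ0 x * (Ms - Mf)))
      (volume.restrict Ω) :=
    (aestronglyMeasurable_const.add (hξ0.mul_const _)).const_mul _
  have hc2 : AEStronglyMeasurable (fun x => ΔsAM * (Af - T0 + ξ0 x * (As - Af)))
      (volume.restrict Ω) :=
    (aestronglyMeasurable_const.add (hξ0.mul_const _)).const_mul _
  have hd := (continuous_dissipation σreo).comp_aestronglyMeasurable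
    ((hc1.prodMk (hc2.prodMk hξ0)).prodMk (hE0.prodMk (hP.prodMk hu.1)))
  simp only [energyDensity, dT_eq_dissipation]
  exact ((((he.const_mul _).add (hu1.const_mul _)).add (hr.const_mul _)).add hn).add hd

theorem exists_bound_energyDensity (hc0 : 0 ≤ c) (hc : ∀ A, IsM A → ‖A‖ ≤ c * g A)
    (hMA : 0 ≤ CMA) (hAM : 0 ≤ CAM)
    (hSApos : ∀ A : Mat, A.IsSymm → A ≠ 0 → 0 < finner (SA A) A)
    (hSMpos : ∀ A : Mat, A.IsSymm → A ≠ 0 → 0 < finner (SM A) A)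
    (hCstmap : ∀ ξ ∈ Set.Icc (0 : ℝ) 1, ∀ A : Mat, A.IsSymm → (Cst ξ A).IsSymm)
    (hCstinv : ∀ ξ ∈ Set.Icc (0 : ℝ) 1, ∀ A : Mat, A.IsSymm →
      (ξ • SM + (1 - ξ) • SA) (Cst ξ A) = A ∧ Cst ξ ((ξ • SM + (1 - ξ) • SA) A) = A)
    (hΔs : 0 ≤ ΔsAM) (hσ : 0 ≤ σreo)
    (hT1 : Mf ≤ Ms) (hT2 : Ms ≤ T0) (hT3 : T0 ≤ As) (hT4 : As ≤ Af) (Ce R : ℝ) :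
    ∃ C, ∀ (e₀ : Mat) (q p : ℝ × Mat) (w : Mat), e₀.IsSymm → ‖e₀‖ ≤ Ce →
      q ∈ admissibleValues g → p ∈ admissibleValues g → ‖w‖ ≤ R →
      |energyDensity lam CMA CAM Cst ΔsAM σreo T0 Ms Mf As Af e₀ q.1 q.2 p w| ≤ C := by
  obtain ⟨α, hα, hcoer⟩ := exists_coercive_mixture hSApos hSMpos
  refine ⟨1 / 2 * (α⁻¹ * (Ce + c) * (Ce + c)) + |lam| + CMA * (c + R) ^ 2 + CAM * R ^ 2 +
    (ΔsAM * (T0 - Mf) + ΔsAM * (Af - T0) + σreo * (4 * c)), ?_⟩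
  intro e₀ q p w he₀ hCe hq hp hw
  have hp2 : ‖p.2‖ ≤ c :=
    (norm_le_of_mem_admissibleValues hc0 hc hp).trans (mul_le_of_le_one_right hc0 hp.2.1)
  have hq2' := norm_le_of_mem_admissibleValues hc0 hc hq
  have hq2 : ‖q.2‖ ≤ c := hq2'.trans (mul_le_of_le_one_right hc0 hq.2.1)
  have hξ : p.1 ∈ Set.Icc (0 : ℝ) 1 := ⟨hp.1, hp.2.1⟩
  have hp1 := hp.1
  have hp1' := hp.2.1
  have hq1 := hq.1
  have hq1' := hq.2.1
  have hz : ‖e₀ - p.2‖ ≤ Ce + c := (norm_sub_le _ _).trans (add_le_add hCe hp2)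
  have hzs : (e₀ - p.2).IsSymm := he₀.sub hp.2.2.1.1
  have b1 : |1 / 2 * finner (Cst p.1 (e₀ - p.2)) (e₀ - p.2)| ≤
      1 / 2 * (α⁻¹ * (Ce + c) * (Ce + c)) := by
    rw [abs_mul, abs_of_pos (by norm_num : (0 : ℝ) < 1 / 2)]
    have h1 := norm_stiffness_le hα hcoer hξ (hCstmap _ hξ _ hzs)
    rw [(hCstinv _ hξ _ hzs).1] at h1
    have h2 : 0 ≤ Ce + c := (norm_nonneg _).trans hz
    refine mul_le_mul_of_nonneg_left ((abs_finner_le _ _).trans ?_) (by norm_num)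
    refine mul_le_mul (h1.trans ?_) hz (norm_nonneg _) (by positivity)
    exact mul_le_mul_of_nonneg_left hz (by positivity)
  have b2 : |lam * p.1| ≤ |lam| := by
    rw [abs_mul, abs_of_nonneg hp.1]
    exact mul_le_of_le_one_right (abs_nonneg _) hp.2.1
  have b3 : |CMA * r1 p.1 p.2 w| ≤ CMA * (c + R) ^ 2 := by
    rw [abs_of_nonneg (mul_nonneg hMA (r1_nonneg _ _ _))]
    refine mul_le_mul_of_nonneg_left ((r1_le hc0 hc hp w).trans ?_) hMA
    refine (mul_le_of_le_one_right (by positivity) hp.2.1).trans ?_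
    gcongr
  have b4 : |CAM * (1 - p.1) * ‖w‖ ^ 2| ≤ CAM * R ^ 2 := by
    have h1 : 0 ≤ 1 - p.1 := by linarith
    rw [abs_of_nonneg (by positivity)]
    refine mul_le_mul (mul_le_of_le_one_right hAM (by linarith)) ?_ (by positivity) hAM
    gcongr
  have b5 : |dT ΔsAM σreo T0 Ms Mf As Af q.2 q.1 (p.2 - q.2) (p.1 - q.1)| ≤
      ΔsAM * (T0 - Mf) + ΔsAM * (Af - T0) + σreo * (4 * c) := by
    obtain ⟨k1, k2, k3, k4⟩ := dT_coefficients_bounds hΔs hT1 hT2 hT3 hT4 hq1 hq1'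
    rw [dT_eq_dissipation]
    refine abs_dissipation_le k1 k2 hσ k3 k4 (abs_le.2 ⟨by linarith, by linarith⟩) hq2 ?_ hp2
    rw [norm_smul, norm_inv, Real.norm_of_nonneg hq1]
    rcases hq1.eq_or_lt with h | h
    · simpa [← h] using hc0
    · rwa [inv_mul_eq_div, div_le_iff₀ h]
  unfold energyDensity
  exact (abs_add_le _ _).trans (add_le_add ((abs_add_le _ _).trans (add_le_add ((abs_add_le _ _).trans
    (add_le_add ((abs_add_le _ _).trans (add_le_add b1 b2)) b3)) b4)) b5)

end EnergyDensity

end Mechanics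

/-- existence of a minimizer of the time-incremental functional `𝔈`
over the admissible set `𝒱` (internal-variable reduction of Proposition 1). -/
theorem stmt14
    (Ω : Set E3) (hΩm : MeasurableSet Ω) (hΩb : Bornology.IsBounded Ω)
    (hΩpos : 0 < MeasureTheory.volume Ω)
    (ω : ℝ) (hω : 0 < ω)
    -- the transformation-strain gauge ⟨·⟩
    (g : Mat → ℝ)
    (hgconv : ConvexOn ℝ {A : Mat | IsM A} g)
    (hghom : ∀ A : Mat, IsM A → ∀ l : ℝ, 0 ≤ l → g (l • A) = l * g A)
    (hgcont : Continuous g)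
    (hgpos : ∀ A : Mat, IsM A → A ≠ 0 → 0 < g A)
    -- the given total-strain field e ∈ L^∞(Ω; Sym)
    (e : E3 → Mat) (hesymm : ∀ x, (e x).IsSymm)
    (hemeas : AEStronglyMeasurable e (volume.restrict Ω))
    (Ce : ℝ) (hebd : ∀ᵐ x ∂volume.restrict Ω, ‖e x‖ ≤ Ce)
    -- chemical-energy coefficient and interaction constants
    (lam : ℝ) (CMA CAM : ℝ) (hMA : 0 ≤ CMA) (hAM : 0 ≤ CAM)
    -- the compliances 𝕊_A, 𝕊_M: symmetric positive-definite operators on Sym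
    (SA SM : Mat →ₗ[ℝ] Mat)
    (hSAmap : ∀ A : Mat, A.IsSymm → (SA A).IsSymm)
    (hSMmap : ∀ A : Mat, A.IsSymm → (SM A).IsSymm)
    (hSAsym : ∀ A B : Mat, A.IsSymm → B.IsSymm → finner (SA A) B = finner A (SA B))
    (hSMsym : ∀ A B : Mat, A.IsSymm → B.IsSymm → finner (SM A) B = finner A (SM B))
    (hSApos : ∀ A : Mat, A.IsSymm → A ≠ 0 → 0 < finner (SA A) A)
    (hSMpos : ∀ A : Mat, A.IsSymm → A ≠ 0 → 0 < finner (SM A) A)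
    -- the stiffness ℂ(ξ) = (ξ𝕊_M + (1−ξ)𝕊_A)⁻¹ on Sym
    (Cst : ℝ → Mat →ₗ[ℝ] Mat)
    (hCstmap : ∀ ξ ∈ Set.Icc (0 : ℝ) 1, ∀ A : Mat, A.IsSymm → (Cst ξ A).IsSymm)
    (hCstinv : ∀ ξ ∈ Set.Icc (0 : ℝ) 1, ∀ A : Mat, A.IsSymm →
      (ξ • SM + (1 - ξ) • SA) (Cst ξ A) = A ∧ Cst ξ ((ξ • SM + (1 - ξ) • SA) A) = A)
    -- dissipation parameters
    (ΔsAM σreo T0 Ms Mf As Af : ℝ) (hΔs : 0 ≤ ΔsAM) (hσ : 0 ≤ σreo)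
    (hT1 : Mf ≤ Ms) (hT2 : Ms ≤ T0) (hT3 : T0 ≤ As) (hT4 : As ≤ Af)
    -- the previous state (ξ₀, E₀) ∈ 𝒱
    (ξ0 : E3 → ℝ) (E0 : E3 → Mat) (hadm0 : Adm Ω g ξ0 E0) :
    ∃ (ξs : E3 → ℝ) (Es : E3 → Mat), Adm Ω g ξs Es ∧
      ∀ (ξ : E3 → ℝ) (E : E3 → Mat), Adm Ω g ξ E →
        ETot Ω ω e lam CMA CAM Cst ΔsAM σreo T0 Ms Mf As Af ξ0 E0 ξs Es ≤
          ETot Ω ω e lam CMA CAM Cst ΔsAM σreo T0 Ms Mf As Af ξ0 E0 ξ E := by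
  obtain ⟨c, hc0, hc⟩ := exists_norm_le_gauge hghom hgcont hgpos
  have : IsFiniteMeasure (volume.restrict Ω) :=
    isFiniteMeasure_restrict.2 hΩb.measure_lt_top.ne
  have hel := continuousOn_elastic hSApos hSMpos hCstmap hCstinv
  have helconv := convexOn_elastic hSAsym hSMsym hSApos hSMpos hCstmap hCstinv
  obtain ⟨C, hC⟩ := exists_bound_energyDensity (lam := lam) hc0 hc hMA hAM hSApos hSMpos hCstmap
    hCstinv hΔs hσ hT1 hT2 hT3 hT4 Ce c
  have hnorm : ∀ u : E3 → ℝ × Mat, IsFieldIn (volume.restrict Ω) (admissibleValues g) u →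
      ∀ᵐ y ∂volume.restrict Ω, ‖(u y).2‖ ≤ c := fun u hu => hu.2.mono fun y hy =>
    (norm_le_of_mem_admissibleValues hc0 hc hy).trans (mul_le_of_le_one_right hc0 hy.2.1)
  obtain ⟨u, hu, hmin⟩ := exists_minimizer_nonlocal (μ := volume.restrict Ω)
    (isCompact_admissibleValues hgcont hc0 hc) (convex_admissibleValues hgconv)
    (avgKernel Ω ω) (memLp_avgKernel hω) (ContinuousLinearMap.snd ℝ ℝ Mat) c
    (fun u hu => (aestronglyMeasurable_nlAvgM
      (continuous_snd.comp_aestronglyMeasurable hu.1)).congr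
        (ae_of_all _ fun x => nlAvgM_eq_integral_avgKernel (ω := ω) (fun y => (u y).2) x))
    (fun u hu x => (nlAvgM_eq_integral_avgKernel (ω := ω) (fun y => (u y).2) x) ▸
      norm_nlAvgM_le hω hc0 (hnorm u hu) x)
    (fun x => energyDensity lam CMA CAM Cst ΔsAM σreo T0 Ms Mf As Af (e x) (ξ0 x) (E0 x))
    (fun u b hu hb => aestronglyMeasurable_energyDensity hel hesymm hemeas hadm0.1 hadm0.2.1 hu hb)
    (by
      filter_upwards [hadm0.2.2] with x hx w
      exact convexOn_energyDensity hgconv hc0 hc hMA helconv hΔs hσ hT1 hT2 hT3 hT4 (hesymm x)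
        hx.1 hx.2.1 _ w)
    (ae_of_all _ fun x => continuousOn_energyDensity hc0 hc hel (hesymm x) _ _)
    C
    (by
      filter_upwards [hadm0.2.2, hebd] with x hx hex p hp w hw
      exact hC (e x) (ξ0 x, E0 x) p w (hesymm x) hex hx hp hw)
    ⟨fun x => (ξ0 x, E0 x), isFieldIn_admissibleValues_iff.2 hadm0⟩
  refine ⟨fun x => (u x).1, fun x => (u x).2, isFieldIn_admissibleValues_iff.1 hu,
    fun ξ E hE => ?_⟩
  have h := hmin (fun x => (ξ x, E x)) (isFieldIn_admissibleValues_iff.2 hE)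
  simp only [← nlAvgM_eq_integral_avgKernel] at h
  exact h
end
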